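/- arXiv:2509.12538 — 5 statements merged into one kernel-verified Lean document; each statement's English description precedes it below -/
import Mathlib

section
/- Partial identification of the direct effect with untreated peer, pairs (Lemma 1, part 1). Assume Assumptions IV, SM and IRR hold and P(D_i(1,0) > D_i(0,0), D_p(0,0) = 0) > 0, so that τ_D(0) = E[Y_i(1,0) − Y_i(0,0) | D_i(1,0) > D_i(0,0), D_p(0,0) = 0] is well defined. Define L = −Δ^{10}_{00}E[Y_i(1−D_p)] / Δ^{10}_{00}E[(1−D_i)(1−D_p)] + (E[Y_i(1−D_i)(1−D_p) | Z=(1,1)] / E[(1−D_i)(1−D_p) | Z=(1,1)]) · (Δ^{10}_{00}E[1−D_p] / Δ^{10}_{00}E[(1−D_i)(1−D_p)]) and U = −Δ^{10}_{00}E[Y_i(1−D_p)] / Δ^{10}_{00}E[(1−D_i)(1−D_p)] + (Δ^{01}_{00}E[Y_i D_i (1−D_p)] / Δ^{01}_{00}E[D_i(1−D_p)]) · (Δ^{10}_{00}E[1−D_p] / Δ^{10}_{00}E[(1−D_i)(1−D_p)]). Then: (a) if P(D_i(1,1)=0, D_p(1,1)=0) > 0 and E[Y_i(1,0) | D_i(1,0)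 > D_i(0,0), D_p(1,0) > D_p(0,0) = 0] ≥ E[Y_i(0,0) | D_i(1,1)=0, D_p(1,1)=0], then L ≤ τ_D(0); (b) if P(D_i(0,0)=1, D_p(0,1) > D_p(0,0) = 0) > 0 and E[Y_i(1,0) | D_i(0,0)=1, D_p(0,1) > D_p(0,0) = 0] ≥ E[Y_i(1,0) | D_i(1,0) > D_i(0,0), D_p(1,0) > D_p(0,0) = 0], then τ_D(0) ≤ U. -/
open MeasureTheory ProbabilityTheory

noncomputable section

/-- Real value of a Boolean indicator. -/
def b2r (b : Bool) : ℝ := if b then 1 else 0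

variable {Ω : Type*}

/-- Conditional expectation of `X` given the event `A`, i.e. `E[X·1_A]/P(A)`. -/
def cexp [MeasurableSpace Ω] (P : Measure Ω) (X : Ω → ℝ) (A : Set Ω) : ℝ :=
  (∫ ω in A, X ω ∂P) / (P A).toReal

/-- The event `{Z_i = z, Z_p = z'}`. -/
def Zev (Zi Zp : Ω → Bool) (z z' : Bool) : Set Ω := {ω | Zi ω = z ∧ Zp ω = z'}

/-- `Δ^{zz'}_{ww'} E[X]`. -/
def dE [MeasurableSpace Ω] (P : Measure Ω) (Zi Zp : Ω → Bool) (X : Ω → ℝ)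
    (z z' w w' : Bool) : ℝ :=
  cexp P X (Zev Zi Zp z z') - cexp P X (Zev Zi Zp w w')

/-- Conditioning on an event of the instruments evaluates an independent variable at the
assigned instrument values. -/
theorem cexp_Zev_eq_integral {β : Type*} [MeasurableSpace β] [MeasurableSpace Ω]
    {P : Measure Ω} [IsProbabilityMeasure P] {Zi Zp : Ω → Bool} {W : Ω → β}
    (hZi : Measurable Zi) (hZp : Measurable Zp) (hW : Measurable W)
    (hIndep : IndepFun (fun ω => (Zi ω, Zp ω)) W P)
    {F : Ω → ℝ} {g : Bool → Bool → β → ℝ} (hg : ∀ z z', Measurable (g z z'))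
    (hF : ∀ ω, F ω = g (Zi ω) (Zp ω) (W ω)) {z z' : Bool}
    (hpos : 0 < P (Zev Zi Zp z z')) :
    cexp P F (Zev Zi Zp z z') = ∫ ω, g z z' (W ω) ∂P := by
  have hZ : MeasurableSet (Zev Zi Zp z z') :=
    (hZi (measurableSet_singleton z)).inter (hZp (measurableSet_singleton z'))
  have hind : IndepFun (fun ω => (Zev Zi Zp z z').indicator (fun _ => (1 : ℝ)) ω)
      (fun ω => g z z' (W ω)) P := by
    have h := hIndep.comp (φ := fun p : Bool × Bool => if p = (z, z') then (1 : ℝ) else 0)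
      (measurable_of_countable _) (hg z z')
    convert h using 1
    · funext ω
      simp [Zev, Set.indicator_apply]
    · rfl
  have hmul := hind.integral_fun_mul_eq_mul_integral
    (measurable_const.indicator hZ).aestronglyMeasurable
    ((hg z z').comp hW).aestronglyMeasurable
  have hset : ∫ ω in Zev Zi Zp z z', F ω ∂P =
      ∫ ω, (Zev Zi Zp z z').indicator (fun _ => (1 : ℝ)) ω * g z z' (W ω) ∂P := by
    rw [← integral_indicator hZ]
    congr 1 with ω
    by_cases hω : ω ∈ Zev Zi Zp z z'
    · simp [hω, hF ω, hω.1, hω.2]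
    · simp [hω]
  have hne : (P (Zev Zi Zp z z')).toReal ≠ 0 :=
    (ENNReal.toReal_pos hpos.ne' (measure_ne_top _ _)).ne'
  rw [cexp, hset, hmul, integral_indicator_const _ hZ]
  simp only [smul_eq_mul, mul_one, Measure.real]
  field_simp

/-- A contrast between two instrument assignments is the mean of the corresponding contrast of
potential variables. -/
theorem dE_eq_integral_sub {β : Type*} [MeasurableSpace β] [MeasurableSpace Ω]
    {P : Measure Ω} [IsProbabilityMeasure P] {Zi Zp : Ω → Bool} {W : Ω → β}
    (hZi : Measurable Zi) (hZp : Measurable Zp) (hW : Measurable W)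
    (hIndep : IndepFun (fun ω => (Zi ω, Zp ω)) W P)
    (hpos : ∀ z z', 0 < P (Zev Zi Zp z z'))
    {F : Ω → ℝ} {g : Bool → Bool → β → ℝ} (hg : ∀ z z', Measurable (g z z'))
    (hint : ∀ z z', Integrable (fun ω => g z z' (W ω)) P)
    (hF : ∀ ω, F ω = g (Zi ω) (Zp ω) (W ω)) (z z' w w' : Bool) :
    dE P Zi Zp F z z' w w' = ∫ ω, (g z z' (W ω) - g w w' (W ω)) ∂P := by
  rw [dE, cexp_Zev_eq_integral hZi hZp hW hIndep hg hF (hpos z z'),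
    cexp_Zev_eq_integral hZi hZp hW hIndep hg hF (hpos w w'),
    integral_sub (hint z z') (hint w w')]

theorem measurable_b2r : Measurable b2r := measurable_of_countable _

theorem b2r_nonneg (b : Bool) : 0 ≤ b2r b := by cases b <;> simp [b2r]

theorem b2r_le_one (b : Bool) : b2r b ≤ 1 := by cases b <;> simp [b2r]

/-- Evaluating a doubly Boolean-indexed family at measurable indices is measurable. -/
theorem measurable_eval_eval {β : Type*} [MeasurableSpace β] {y : β → Bool → Bool → ℝ}
    {a b : β → Bool} (hy : Measurable y) (ha : Measurable a) (hb : Measurable b) :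
    Measurable fun x => y x (a x) (b x) := by
  have h : (fun x => y x (a x) (b x)) = fun x =>
      if a x = true then (if b x = true then y x true true else y x true false)
      else (if b x = true then y x false true else y x false false) := by
    funext x
    cases a x <;> cases b x <;> rfl
  have hc : ∀ d d', Measurable fun x => y x d d' := fun d d' =>
    (measurable_pi_apply d').comp ((measurable_pi_apply d).comp hy)
  rw [h]
  exact Measurable.ite (ha (measurableSet_singleton true))
    (Measurable.ite (hb (measurableSet_singleton true)) (hc _ _) (hc _ _))
    (Measurable.ite (hb (measurableSet_singleton true)) (hc _ _) (hc _ _))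

/-- The outcome realised under random treatments, with a weight in `[0, 1]`, is integrable. -/
theorem integrable_realised_mul [MeasurableSpace Ω] {P : Measure Ω} {Y : Bool → Bool → Ω → ℝ}
    (hY : ∀ d d', Integrable (Y d d') P) (hYm : ∀ d d', Measurable (Y d d'))
    {A B : Ω → Bool} (hA : Measurable A) (hB : Measurable B)
    {v : Ω → ℝ} (hv : Measurable v) (hv0 : ∀ ω, 0 ≤ v ω) (hv1 : ∀ ω, v ω ≤ 1) :
    Integrable (fun ω => Y (A ω) (B ω) ω * v ω) P := by
  have hm : Measurable fun ω => Y (A ω) (B ω) ω :=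
    measurable_eval_eval (y := fun ω d d' => Y d d' ω)
      (measurable_pi_lambda _ fun d => measurable_pi_lambda _ fun d' => hYm d d') hA hB
  have hb : Integrable (fun ω => |Y true true ω| + |Y true false ω| + |Y false true ω| +
      |Y false false ω|) P :=
    (((hY _ _).abs.add (hY _ _).abs).add (hY _ _).abs).add (hY _ _).abs
  refine hb.mono' (hm.mul hv).aestronglyMeasurable (ae_of_all _ fun ω => ?_)
  rw [Real.norm_eq_abs, abs_mul, abs_of_nonneg (hv0 ω)]
  refine (mul_le_of_le_one_right (abs_nonneg _) (hv1 ω)).trans ?_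
  have h1 := abs_nonneg (Y true true ω)
  have h2 := abs_nonneg (Y true false ω)
  have h3 := abs_nonneg (Y false true ω)
  have h4 := abs_nonneg (Y false false ω)
  cases A ω <;> cases B ω <;> linarith

/-- Lemma 1, part 1: partial identification of the direct effect `τ_D(0)` with
untreated peer, in the one-peer (pairs) setting. -/
theorem direct_effect_untreated_peer_pairs
    [MeasurableSpace Ω] (P : Measure Ω) [IsProbabilityMeasure P]
    (Zi Zp : Ω → Bool) (Di Dp : Bool → Bool → Ω → Bool) (Y : Bool → Bool → Ω → ℝ)
    (hZi : Measurable Zi) (hZp : Measurable Zp)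
    (hDi : ∀ z z', Measurable (Di z z')) (hDp : ∀ z z', Measurable (Dp z z'))
    (hYm : ∀ d d', Measurable (Y d d')) (hYint : ∀ d d', Integrable (Y d d') P)
    (hZpos : ∀ z z', 0 < P (Zev Zi Zp z z'))
    -- Assumption IV: independence and own-instrument monotonicity
    (hIndep : IndepFun (fun ω => (Zi ω, Zp ω))
      (fun ω => ((fun z z' => Di z z' ω, fun z z' => Dp z z' ω),
        fun d d' => Y d d' ω)) P)
    (hIV : ∀ᵐ ω ∂P, ∀ z, Di false z ω ≤ Di true z ω ∧ Dp z false ω ≤ Dp z true ω)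
    -- Assumption SM: monotonicity in the spillovers
    (hSM : ∀ᵐ ω ∂P, ∀ z, Di z false ω ≤ Di z true ω ∧ Dp false z ω ≤ Dp true z ω)
    -- Assumption IRR: irrelevance
    (hIRR : ∀ᵐ ω ∂P, ∀ z,
      (Di true z ω = Di false z ω → Dp true z ω = Dp false z ω) ∧
      (Dp z true ω = Dp z false ω → Di z true ω = Di z false ω))
    -- observed variables
    (DiO DpO : Ω → Bool) (YO : Ω → ℝ)
    (hDiO : ∀ ω, DiO ω = Di (Zi ω) (Zp ω) ω)
    (hDpO : ∀ ω, DpO ω = Dp (Zi ω) (Zp ω) ω)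
    (hYO : ∀ ω, YO ω = Y (DiO ω) (DpO ω) ω)
    -- the complier event {D_i(1,0) > D_i(0,0), D_p(0,0) = 0} and τ_D(0)
    (T : Set Ω)
    (hT : T = {ω | Di true false ω = true ∧ Di false false ω = false ∧
      Dp false false ω = false})
    (hTpos : 0 < P T)
    -- the event {D_i(1,0) > D_i(0,0), D_p(1,0) > D_p(0,0) = 0}
    (SC : Set Ω)
    (hSC : SC = {ω | Di true false ω = true ∧ Di false false ω = false ∧
      Dp true false ω = true ∧ Dp false false ω = false})
    (hSCpos : 0 < P SC)
    -- the event {D_i(1,1)=0, D_p(1,1)=0}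
    (NN : Set Ω)
    (hNN : NN = {ω | Di true true ω = false ∧ Dp true true ω = false})
    -- the event {D_i(0,0)=1, D_p(0,1) > D_p(0,0) = 0}
    (AC : Set Ω)
    (hAC : AC = {ω | Di false false ω = true ∧ Dp false true ω = true ∧
      Dp false false ω = false})
    (τ L U : ℝ)
    (hτ : τ = cexp P (fun ω => Y true false ω - Y false false ω) T)
    (hL : L =
      -(dE P Zi Zp (fun ω => YO ω * (1 - b2r (DpO ω))) true false false false) /
        dE P Zi Zp (fun ω => (1 - b2r (DiO ω)) * (1 - b2r (DpO ω))) true false false false +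
      (cexp P (fun ω => YO ω * (1 - b2r (DiO ω)) * (1 - b2r (DpO ω))) (Zev Zi Zp true true) /
        cexp P (fun ω => (1 - b2r (DiO ω)) * (1 - b2r (DpO ω))) (Zev Zi Zp true true)) *
      (dE P Zi Zp (fun ω => 1 - b2r (DpO ω)) true false false false /
        dE P Zi Zp (fun ω => (1 - b2r (DiO ω)) * (1 - b2r (DpO ω))) true false false false))
    (hU : U =
      -(dE P Zi Zp (fun ω => YO ω * (1 - b2r (DpO ω))) true false false false) /
        dE P Zi Zp (fun ω => (1 - b2r (DiO ω)) * (1 - b2r (DpO ω))) true false false false +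
      (dE P Zi Zp (fun ω => YO ω * b2r (DiO ω) * (1 - b2r (DpO ω))) false true false false /
        dE P Zi Zp (fun ω => b2r (DiO ω) * (1 - b2r (DpO ω))) false true false false) *
      (dE P Zi Zp (fun ω => 1 - b2r (DpO ω)) true false false false /
        dE P Zi Zp (fun ω => (1 - b2r (DiO ω)) * (1 - b2r (DpO ω))) true false false false)) :
    ((0 < P NN ∧
        cexp P (Y true false) SC ≥ cexp P (Y false false) NN) → L ≤ τ) ∧
    ((0 < P AC ∧
        cexp P (Y true false) AC ≥ cexp P (Y true false) SC) → τ ≤ U) := by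
  have hW : Measurable (fun ω => ((fun z z' => Di z z' ω, fun z z' => Dp z z' ω),
      fun d d' => Y d d' ω) : Ω → ((Bool → Bool → Bool) × (Bool → Bool → Bool)) ×
        (Bool → Bool → ℝ)) := by
    refine Measurable.prodMk (Measurable.prodMk ?_ ?_) ?_ <;>
      refine measurable_pi_lambda _ fun d => measurable_pi_lambda _ fun d' => ?_
    exacts [hDi d d', hDp d d', hYm d d']
  have hdi : ∀ z z', Measurable fun x : ((Bool → Bool → Bool) × (Bool → Bool → Bool)) ×
      (Bool → Bool → ℝ) => x.1.1 z z' := fun z z' => (measurable_pi_apply z').comp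
    ((measurable_pi_apply z).comp (measurable_fst.comp measurable_fst))
  have hdp : ∀ z z', Measurable fun x : ((Bool → Bool → Bool) × (Bool → Bool → Bool)) ×
      (Bool → Bool → ℝ) => x.1.2 z z' := fun z z' => (measurable_pi_apply z').comp
    ((measurable_pi_apply z).comp (measurable_snd.comp measurable_fst))
  have hy : ∀ z z', Measurable fun x : ((Bool → Bool → Bool) × (Bool → Bool → Bool)) ×
      (Bool → Bool → ℝ) => x.2 (x.1.1 z z') (x.1.2 z z') := fun z z' =>
    measurable_eval_eval measurable_snd (hdi z z') (hdp z z')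
  have hbdi := fun z z' => measurable_b2r.comp (hdi z z')
  have hbdp := fun z z' => measurable_b2r.comp (hdp z z')
  have hBi := fun z z' => measurable_b2r.comp (hDi z z')
  have hBp := fun z z' => measurable_b2r.comp (hDp z z')
  have hcontrol0 : ∀ a, 0 ≤ 1 - b2r a := fun a => sub_nonneg.2 (b2r_le_one a)
  have hcontrol1 : ∀ a, 1 - b2r a ≤ 1 := fun a => sub_le_self 1 (b2r_nonneg a)
  have hone : ∀ d d' : Bool, Integrable ((fun _ _ _ => 1 : Bool → Bool → Ω → ℝ) d d') P :=
    fun _ _ => integrable_const 1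
  have honem : ∀ d d' : Bool, Measurable ((fun _ _ _ => 1 : Bool → Bool → Ω → ℝ) d d') :=
    fun _ _ => measurable_const
  have hTm : MeasurableSet T := by
    rw [hT]
    exact (hDi true false (measurableSet_singleton true)).inter
      ((hDi false false (measurableSet_singleton false)).inter
        (hDp false false (measurableSet_singleton false)))
  have hSCm : MeasurableSet SC := by
    rw [hSC]
    exact (hDi true false (measurableSet_singleton true)).inter
      ((hDi false false (measurableSet_singleton false)).inter
        ((hDp true false (measurableSet_singleton true)).inter
          (hDp false false (measurableSet_singleton false))))
  have hNNm : MeasurableSet NN := by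
    rw [hNN]
    exact (hDi true true (measurableSet_singleton false)).inter
      (hDp true true (measurableSet_singleton false))
  have hACm : MeasurableSet AC := by
    rw [hAC]
    exact (hDi false false (measurableSet_singleton true)).inter
      ((hDp false true (measurableSet_singleton true)).inter
        (hDp false false (measurableSet_singleton false)))
  have hYDp : dE P Zi Zp (fun ω => YO ω * (1 - b2r (DpO ω))) true false false false =
      (∫ ω in T, (Y true false ω - Y false false ω) ∂P) - ∫ ω in SC, Y true false ω ∂P := by
    rw [dE_eq_integral_sub hZi hZp hW hIndep hZpos
      (g := fun z z' x => x.2 (x.1.1 z z') (x.1.2 z z') * (1 - b2r (x.1.2 z z')))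
      (fun z z' => (hy z z').mul (measurable_const.sub (hbdp z z')))
      (fun z z' => integrable_realised_mul hYint hYm (hDi z z') (hDp z z')
        (measurable_const.sub (hBp z z')) (fun _ => hcontrol0 _) (fun _ => hcontrol1 _))
      (fun ω => by simp only [hYO, hDiO, hDpO])]
    rw [← integral_indicator hTm, ← integral_indicator hSCm, ← integral_sub
      (Integrable.indicator (f := fun ω => Y true false ω - Y false false ω)
        ((hYint _ _).sub (hYint _ _)) hTm) ((hYint _ _).indicator hSCm)]
    refine integral_congr_ae ?_
    filter_upwards [hIV, hSM, hIRR] with ω h1 h2 h3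
    have h1 := (h1 false).1
    have h2 := (h2 false).2
    have h3 := (h3 false).1
    subst hT hSC
    simp only [Set.indicator_apply, Set.mem_ofPred_eq]
    revert h1 h2 h3
    rcases (Di true false ω).eq_false_or_eq_true with a | a <;>
      rcases (Di false false ω).eq_false_or_eq_true with b | b <;>
      rcases (Dp true false ω).eq_false_or_eq_true with c | c <;>
      rcases (Dp false false ω).eq_false_or_eq_true with d | d <;>
      simp [b2r, a, b, c, d]
  have hDiDp : dE P Zi Zp (fun ω => (1 - b2r (DiO ω)) * (1 - b2r (DpO ω)))
      true false false false = -P.real T := by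
    rw [dE_eq_integral_sub hZi hZp hW hIndep hZpos
      (g := fun z z' x => 1 * ((1 - b2r (x.1.1 z z')) * (1 - b2r (x.1.2 z z'))))
      (fun z z' => measurable_const.mul
        ((measurable_const.sub (hbdi z z')).mul (measurable_const.sub (hbdp z z'))))
      (fun z z' => integrable_realised_mul hone honem (hDi z z') (hDp z z')
        ((measurable_const.sub (hBi z z')).mul (measurable_const.sub (hBp z z')))
        (fun _ => mul_nonneg (hcontrol0 _) (hcontrol0 _))
        (fun _ => mul_le_one₀ (hcontrol1 _) (hcontrol0 _) (hcontrol1 _)))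
      (fun ω => by simp only [hDiO, hDpO, one_mul])]
    rw [← integral_indicator_one hTm, ← integral_neg]
    refine integral_congr_ae ?_
    filter_upwards [hIV, hSM, hIRR] with ω h1 h2 h3
    have h1 := (h1 false).1
    have h2 := (h2 false).2
    have h3 := (h3 false).1
    subst hT
    simp only [Set.indicator_apply, Set.mem_ofPred_eq]
    revert h1 h2 h3
    rcases (Di true false ω).eq_false_or_eq_true with a | a <;>
      rcases (Di false false ω).eq_false_or_eq_true with b | b <;>
      rcases (Dp true false ω).eq_false_or_eq_true with c | c <;>
      rcases (Dp false false ω).eq_false_or_eq_true with d | d <;>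
      simp [b2r, a, b, c, d]
  have hDpOnly : dE P Zi Zp (fun ω => 1 - b2r (DpO ω)) true false false false =
      -P.real SC := by
    rw [dE_eq_integral_sub hZi hZp hW hIndep hZpos
      (g := fun z z' x => 1 * (1 - b2r (x.1.2 z z')))
      (fun z z' => measurable_const.mul (measurable_const.sub (hbdp z z')))
      (fun z z' => integrable_realised_mul hone honem (hDi z z') (hDp z z')
        (measurable_const.sub (hBp z z')) (fun _ => hcontrol0 _) (fun _ => hcontrol1 _))
      (fun ω => by simp only [hDpO, one_mul])]
    rw [← integral_indicator_one hSCm, ← integral_neg]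
    refine integral_congr_ae ?_
    filter_upwards [hIV, hSM, hIRR] with ω h1 h2 h3
    have h1 := (h1 false).1
    have h2 := (h2 false).2
    have h3 := (h3 false).1
    subst hSC
    simp only [Set.indicator_apply, Set.mem_ofPred_eq]
    revert h1 h2 h3
    rcases (Di true false ω).eq_false_or_eq_true with a | a <;>
      rcases (Di false false ω).eq_false_or_eq_true with b | b <;>
      rcases (Dp true false ω).eq_false_or_eq_true with c | c <;>
      rcases (Dp false false ω).eq_false_or_eq_true with d | d <;>
      simp [b2r, a, b, c, d]
  have hYNN : cexp P (fun ω => YO ω * (1 - b2r (DiO ω)) * (1 - b2r (DpO ω)))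
      (Zev Zi Zp true true) = ∫ ω in NN, Y false false ω ∂P := by
    rw [cexp_Zev_eq_integral hZi hZp hW hIndep
      (g := fun z z' x => x.2 (x.1.1 z z') (x.1.2 z z') * (1 - b2r (x.1.1 z z')) *
        (1 - b2r (x.1.2 z z')))
      (fun z z' => ((hy z z').mul (measurable_const.sub (hbdi z z'))).mul
        (measurable_const.sub (hbdp z z')))
      (fun ω => by simp only [hYO, hDiO, hDpO]) (hZpos _ _), ← integral_indicator hNNm]
    congr 1 with ω
    subst hNN
    simp only [Set.indicator_apply, Set.mem_ofPred_eq]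
    rcases (Di true true ω).eq_false_or_eq_true with a | a <;>
      rcases (Dp true true ω).eq_false_or_eq_true with b | b <;>
      simp [b2r, a, b]
  have hPNN : cexp P (fun ω => (1 - b2r (DiO ω)) * (1 - b2r (DpO ω)))
      (Zev Zi Zp true true) = P.real NN := by
    rw [cexp_Zev_eq_integral hZi hZp hW hIndep
      (g := fun z z' x => (1 - b2r (x.1.1 z z')) * (1 - b2r (x.1.2 z z')))
      (fun z z' => (measurable_const.sub (hbdi z z')).mul (measurable_const.sub (hbdp z z')))
      (fun ω => by simp only [hDiO, hDpO]) (hZpos _ _), ← integral_indicator_one hNNm]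
    congr 1 with ω
    subst hNN
    simp only [Set.indicator_apply, Set.mem_ofPred_eq]
    rcases (Di true true ω).eq_false_or_eq_true with a | a <;>
      rcases (Dp true true ω).eq_false_or_eq_true with b | b <;>
      simp [b2r, a, b]
  have hYAC : dE P Zi Zp (fun ω => YO ω * b2r (DiO ω) * (1 - b2r (DpO ω)))
      false true false false = -∫ ω in AC, Y true false ω ∂P := by
    rw [dE_eq_integral_sub hZi hZp hW hIndep hZpos
      (g := fun z z' x => x.2 (x.1.1 z z') (x.1.2 z z') *
        (b2r (x.1.1 z z') * (1 - b2r (x.1.2 z z'))))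
      (fun z z' => (hy z z').mul ((hbdi z z').mul (measurable_const.sub (hbdp z z'))))
      (fun z z' => integrable_realised_mul hYint hYm (hDi z z') (hDp z z')
        ((hBi z z').mul (measurable_const.sub (hBp z z')))
        (fun _ => mul_nonneg (b2r_nonneg _) (hcontrol0 _))
        (fun _ => mul_le_one₀ (b2r_le_one _) (hcontrol0 _) (hcontrol1 _)))
      (fun ω => by simp only [hYO, hDiO, hDpO, mul_assoc])]
    rw [← integral_indicator hACm, ← integral_neg]
    refine integral_congr_ae ?_
    filter_upwards [hIV, hIRR] with ω h1 h2
    have h1 := (h1 false).2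
    have h2 := (h2 false).2
    subst hAC
    simp only [Set.indicator_apply, Set.mem_ofPred_eq]
    revert h1 h2
    rcases (Di false true ω).eq_false_or_eq_true with a | a <;>
      rcases (Di false false ω).eq_false_or_eq_true with b | b <;>
      rcases (Dp false true ω).eq_false_or_eq_true with c | c <;>
      rcases (Dp false false ω).eq_false_or_eq_true with d | d <;>
      simp [b2r, a, b, c, d]
  have hPAC : dE P Zi Zp (fun ω => b2r (DiO ω) * (1 - b2r (DpO ω)))
      false true false false = -P.real AC := by
    rw [dE_eq_integral_sub hZi hZp hW hIndep hZpos
      (g := fun z z' x => 1 * (b2r (x.1.1 z z') * (1 - b2r (x.1.2 z z'))))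
      (fun z z' => measurable_const.mul
        ((hbdi z z').mul (measurable_const.sub (hbdp z z'))))
      (fun z z' => integrable_realised_mul hone honem (hDi z z') (hDp z z')
        ((hBi z z').mul (measurable_const.sub (hBp z z')))
        (fun _ => mul_nonneg (b2r_nonneg _) (hcontrol0 _))
        (fun _ => mul_le_one₀ (b2r_le_one _) (hcontrol0 _) (hcontrol1 _)))
      (fun ω => by simp only [hDiO, hDpO, one_mul])]
    rw [← integral_indicator_one hACm, ← integral_neg]
    refine integral_congr_ae ?_
    filter_upwards [hIV, hIRR] with ω h1 h2
    have h1 := (h1 false).2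
    have h2 := (h2 false).2
    subst hAC
    simp only [Set.indicator_apply, Set.mem_ofPred_eq]
    revert h1 h2
    rcases (Di false true ω).eq_false_or_eq_true with a | a <;>
      rcases (Di false false ω).eq_false_or_eq_true with b | b <;>
      rcases (Dp false true ω).eq_false_or_eq_true with c | c <;>
      rcases (Dp false false ω).eq_false_or_eq_true with d | d <;>
      simp [b2r, a, b, c, d]
  have hp : 0 < P.real T := ENNReal.toReal_pos hTpos.ne' (measure_ne_top _ _)
  have hq : 0 < P.real SC := ENNReal.toReal_pos hSCpos.ne' (measure_ne_top _ _)
  have hbound : ∀ r : ℝ, -((∫ ω in T, (Y true false ω - Y false false ω) ∂P) -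
      ∫ ω in SC, Y true false ω ∂P) / -P.real T + r * (-P.real SC / -P.real T) =
      τ + (r - cexp P (Y true false) SC) * (P.real SC / P.real T) := by
    intro r
    rw [hτ, cexp, cexp, ← measureReal_def, ← measureReal_def]
    field_simp
    ring
  rw [hYDp, hDiDp, hDpOnly, hYNN, hPNN, hbound] at hL
  rw [hYDp, hDiDp, hDpOnly, hYAC, hPAC, hbound, neg_div_neg_eq] at hU
  have hratio : 0 ≤ P.real SC / P.real T := (div_pos hq hp).le
  refine ⟨fun h => ?_, fun h => ?_⟩
  · rw [hL]
    exact add_le_of_nonpos_right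
      (mul_nonpos_of_nonpos_of_nonneg (sub_nonpos.2 h.2) hratio)
  · rw [hU]
    exact le_add_of_nonneg_right (mul_nonneg (sub_nonneg.2 h.2) hratio)

end
end

section
/- Partial identification of the spillover effect on untreated individuals, pairs (Lemma 2, part 1). Assume Assumptions IV, SM and IRR hold and P(D_i(0,0) = 0, D_p(0,1) > D_p(0,0)) > 0, so that τ_S(0) = E[Y_i(0,1) − Y_i(0,0) | D_i(0,0) = 0, D_p(0,1) > D_p(0,0)] is well defined. Define L = −Δ^{01}_{00}E[Y_i(1−D_i)] / Δ^{01}_{00}E[(1−D_i)(1−D_p)] − (Δ^{11}_{10}E[Y_i(1−D_i)D_p] / Δ^{11}_{10}E[(1−D_i)D_p]) · (Δ^{01}_{00}E[D_i] / Δ^{01}_{00}E[(1−D_i)(1−D_p)]) and U = −Δ^{01}_{00}E[Y_i(1−D_i)] / Δ^{01}_{00}E[(1−D_i)(1−D_p)] − (E[Y_i D_i D_p | Z=(0,0)] / E[D_i D_p | Z=(0,0)]) · (Δ^{01}_{00}E[D_i] / Δ^{01}_{00}E[(1−D_i)(1−D_p)]). Then: (a) if P(D_i(1,1)=0, D_p(1,1)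 > D_p(1,0)) > 0 and E[Y_i(0,1) | D_i(0,1) > D_i(0,0), D_p(0,1) > D_p(0,0)] ≥ E[Y_i(0,1) | D_i(1,1)=0, D_p(1,1) > D_p(1,0)], then L ≤ τ_S(0); (b) if P(D_i(0,0)=1, D_p(0,0)=1) > 0 and E[Y_i(1,1) | D_i(0,0)=1, D_p(0,0)=1] ≥ E[Y_i(0,1) | D_i(0,1) > D_i(0,0), D_p(0,1) > D_p(0,0)], then τ_S(0) ≤ U. -/
open MeasureTheory ProbabilityTheory

noncomputable section

variable {Ω : Type*}

/-- Composing a family of integrable functions with a measurable random index. -/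
lemma integrable_select [MeasurableSpace Ω] {P : Measure Ω} {ι : Type*} [Fintype ι]
    [MeasurableSpace ι] [MeasurableSingletonClass ι] {F : ι → Ω → ℝ} {s : Ω → ι}
    (hs : Measurable s) (hF : ∀ i, Integrable (F i) P) :
    Integrable (fun ω => F (s ω) ω) P := by
  classical
  have h : (fun ω => F (s ω) ω) = fun ω => ∑ i, (s ⁻¹' {i}).indicator (F i) ω := by
    funext ω
    simp [Set.indicator_apply]
  rw [h]
  exact integrable_finsetSum _ fun i _ => (hF i).indicator (hs (measurableSet_singleton i))

lemma measurable_select {β ι : Type*} [MeasurableSpace β] [Countable ι]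
    [MeasurableSpace ι] [MeasurableSingletonClass ι] {F : ι → β → ℝ} {s : β → ι}
    (hs : Measurable s) (hF : ∀ i, Measurable (F i)) :
    Measurable (fun x => F (s x) x) := by
  have h : Measurable fun q : ι × β => F q.1 q.2 := measurable_from_prod_countable_right hF
  exact h.comp (hs.prodMk measurable_id)

lemma measurableSet_Zev [MeasurableSpace Ω] {Zi Zp : Ω → Bool}
    (hZi : Measurable Zi) (hZp : Measurable Zp) (z z' : Bool) :
    MeasurableSet (Zev Zi Zp z z') :=
  (hZi (measurableSet_singleton z)).inter (hZp (measurableSet_singleton z'))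

/-- Conditioning on the instruments does not change the law of a variable independent of them. -/
lemma cexp_Zev_of_indepFun [MeasurableSpace Ω] {P : Measure Ω} [IsProbabilityMeasure P]
    {β : Type*} [MeasurableSpace β] {Zi Zp : Ω → Bool} {W : Ω → β} {φ : β → ℝ} {X : Ω → ℝ}
    {z z' : Bool} (hZi : Measurable Zi) (hZp : Measurable Zp) (hW : AEMeasurable W P)
    (hpos : 0 < P (Zev Zi Zp z z'))
    (hind : IndepFun (fun ω => (Zi ω, Zp ω)) W P) (hφ : Measurable φ)
    (hX : ∀ ω ∈ Zev Zi Zp z z', X ω = φ (W ω)) :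
    cexp P X (Zev Zi Zp z z') = ∫ ω, φ (W ω) ∂P := by
  have hA := measurableSet_Zev hZi hZp z z'
  have hZ : Measurable fun ω => (Zi ω, Zp ω) := hZi.prodMk hZp
  have hAm : MeasurableSet[MeasurableSpace.comap (fun ω => (Zi ω, Zp ω)) inferInstance]
      (Zev Zi Zp z z') :=
    ⟨{(z, z')}, measurableSet_singleton _, by ext ω; simp [Zev]⟩
  have hmul := Indep.setIntegral_eq_mul (f := φ) hZ.comap_le hind hW hAm
    hφ.aestronglyMeasurable
  have hne : (P (Zev Zi Zp z z')).toReal ≠ 0 :=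
    (ENNReal.toReal_pos hpos.ne' (measure_ne_top _ _)).ne'
  rw [cexp, setIntegral_congr_fun hA hX, hmul, Measure.real, mul_div_cancel_left₀ _ hne]

/-- A functional of the observed treatments and outcome, conditionally on the instruments, has
the mean of the same functional of the corresponding potential treatments and outcome. -/
lemma cexp_Zev_observed [MeasurableSpace Ω] {P : Measure Ω} [IsProbabilityMeasure P]
    {Zi Zp : Ω → Bool} {Di Dp : Bool → Bool → Ω → Bool} {Y : Bool → Bool → Ω → ℝ}
    (hZi : Measurable Zi) (hZp : Measurable Zp)
    (hDi : ∀ z z', Measurable (Di z z')) (hDp : ∀ z z', Measurable (Dp z z'))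
    (hYm : ∀ d d', Measurable (Y d d'))
    (hZpos : ∀ z z', 0 < P (Zev Zi Zp z z'))
    (hIndep : IndepFun (fun ω => (Zi ω, Zp ω))
      (fun ω => ((fun z z' => Di z z' ω, fun z z' => Dp z z' ω),
        fun d d' => Y d d' ω)) P)
    {H : Bool × Bool → ℝ → ℝ} (hH : ∀ p, Measurable (H p)) {X : Ω → ℝ}
    (hX : ∀ ω, X ω = H (Di (Zi ω) (Zp ω) ω, Dp (Zi ω) (Zp ω) ω)
      (Y (Di (Zi ω) (Zp ω) ω) (Dp (Zi ω) (Zp ω) ω) ω)) (z z' : Bool) :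
    cexp P X (Zev Zi Zp z z') =
      ∫ ω, H (Di z z' ω, Dp z z' ω) (Y (Di z z' ω) (Dp z z' ω) ω) ∂P := by
  refine cexp_Zev_of_indepFun hZi hZp (Measurable.aemeasurable ?_) (hZpos z z') hIndep
    (φ := fun w => H (w.1.1 z z', w.1.2 z z') (w.2 (w.1.1 z z') (w.1.2 z z'))) ?_ ?_
  · fun_prop
  · exact measurable_select (F := fun p (w : ((Bool → Bool → Bool) × (Bool → Bool → Bool)) ×
        (Bool → Bool → ℝ)) => H p (w.2 p.1 p.2)) (s := fun w => (w.1.1 z z', w.1.2 z z'))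
      (by fun_prop) fun p => (hH p).comp (by fun_prop)
  · rintro ω ⟨rfl, rfl⟩
    exact hX ω

lemma dE_observed [MeasurableSpace Ω] {P : Measure Ω} [IsProbabilityMeasure P]
    {Zi Zp : Ω → Bool} {Di Dp : Bool → Bool → Ω → Bool} {Y : Bool → Bool → Ω → ℝ}
    (hZi : Measurable Zi) (hZp : Measurable Zp)
    (hDi : ∀ z z', Measurable (Di z z')) (hDp : ∀ z z', Measurable (Dp z z'))
    (hYm : ∀ d d', Measurable (Y d d'))
    (hZpos : ∀ z z', 0 < P (Zev Zi Zp z z'))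
    (hIndep : IndepFun (fun ω => (Zi ω, Zp ω))
      (fun ω => ((fun z z' => Di z z' ω, fun z z' => Dp z z' ω),
        fun d d' => Y d d' ω)) P)
    {H : Bool × Bool → ℝ → ℝ} (hH : ∀ p, Measurable (H p))
    (hint : ∀ p : Bool × Bool, Integrable (fun ω => H p (Y p.1 p.2 ω)) P) {X : Ω → ℝ}
    (hX : ∀ ω, X ω = H (Di (Zi ω) (Zp ω) ω, Dp (Zi ω) (Zp ω) ω)
      (Y (Di (Zi ω) (Zp ω) ω) (Dp (Zi ω) (Zp ω) ω) ω)) (z z' w w' : Bool) :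
    dE P Zi Zp X z z' w w' =
      ∫ ω, (H (Di z z' ω, Dp z z' ω) (Y (Di z z' ω) (Dp z z' ω) ω) -
        H (Di w w' ω, Dp w w' ω) (Y (Di w w' ω) (Dp w w' ω) ω)) ∂P := by
  have hI : ∀ v v', Integrable
      (fun ω => H (Di v v' ω, Dp v v' ω) (Y (Di v v' ω) (Dp v v' ω) ω)) P := fun v v' =>
    integrable_select (F := fun p ω => H p (Y p.1 p.2 ω))
      ((hDi v v').prodMk (hDp v v')) hint
  rw [dE, cexp_Zev_observed hZi hZp hDi hDp hYm hZpos hIndep hH hX,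
    cexp_Zev_observed hZi hZp hDi hDp hYm hZpos hIndep hH hX, integral_sub (hI _ _) (hI _ _)]

/-- Lemma 2, part 1: partial identification of the spillover effect `τ_S(0)` on
untreated individuals, in the one-peer (pairs) setting. -/
theorem spillover_effect_untreated_pairs
    [MeasurableSpace Ω] (P : Measure Ω) [IsProbabilityMeasure P]
    (Zi Zp : Ω → Bool) (Di Dp : Bool → Bool → Ω → Bool) (Y : Bool → Bool → Ω → ℝ)
    (hZi : Measurable Zi) (hZp : Measurable Zp)
    (hDi : ∀ z z', Measurable (Di z z')) (hDp : ∀ z z', Measurable (Dp z z'))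
    (hYm : ∀ d d', Measurable (Y d d')) (hYint : ∀ d d', Integrable (Y d d') P)
    (hZpos : ∀ z z', 0 < P (Zev Zi Zp z z'))
    -- Assumption IV: independence and own-instrument monotonicity
    (hIndep : IndepFun (fun ω => (Zi ω, Zp ω))
      (fun ω => ((fun z z' => Di z z' ω, fun z z' => Dp z z' ω),
        fun d d' => Y d d' ω)) P)
    (hIV : ∀ᵐ ω ∂P, ∀ z, Di false z ω ≤ Di true z ω ∧ Dp z false ω ≤ Dp z true ω)
    -- Assumption SM: monotonicity in the spillovers
    (hSM : ∀ᵐ ω ∂P, ∀ z, Di z false ω ≤ Di z true ω ∧ Dp false z ω ≤ Dp true z ω)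
    -- Assumption IRR: irrelevance
    (hIRR : ∀ᵐ ω ∂P, ∀ z,
      (Di true z ω = Di false z ω → Dp true z ω = Dp false z ω) ∧
      (Dp z true ω = Dp z false ω → Di z true ω = Di z false ω))
    -- observed variables
    (DiO DpO : Ω → Bool) (YO : Ω → ℝ)
    (hDiO : ∀ ω, DiO ω = Di (Zi ω) (Zp ω) ω)
    (hDpO : ∀ ω, DpO ω = Dp (Zi ω) (Zp ω) ω)
    (hYO : ∀ ω, YO ω = Y (DiO ω) (DpO ω) ω)
    -- the event {D_i(0,0) = 0, D_p(0,1) > D_p(0,0)} and τ_S(0)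
    (T : Set Ω)
    (hT : T = {ω | Di false false ω = false ∧ Dp false true ω = true ∧
      Dp false false ω = false})
    (hTpos : 0 < P T)
    -- the event {D_i(0,1) > D_i(0,0), D_p(0,1) > D_p(0,0)}
    (SP : Set Ω)
    (hSP : SP = {ω | Di false true ω = true ∧ Di false false ω = false ∧
      Dp false true ω = true ∧ Dp false false ω = false})
    (hSPpos : 0 < P SP)
    -- the event {D_i(1,1)=0, D_p(1,1) > D_p(1,0)}
    (NC : Set Ω)
    (hNC : NC = {ω | Di true true ω = false ∧ Dp true true ω = true ∧
      Dp true false ω = false})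
    -- the event {D_i(0,0)=1, D_p(0,0)=1}
    (AA : Set Ω)
    (hAA : AA = {ω | Di false false ω = true ∧ Dp false false ω = true})
    (τ L U : ℝ)
    (hτ : τ = cexp P (fun ω => Y false true ω - Y false false ω) T)
    (hL : L =
      -(dE P Zi Zp (fun ω => YO ω * (1 - b2r (DiO ω))) false true false false) /
        dE P Zi Zp (fun ω => (1 - b2r (DiO ω)) * (1 - b2r (DpO ω))) false true false false -
      (dE P Zi Zp (fun ω => YO ω * (1 - b2r (DiO ω)) * b2r (DpO ω)) true true true false /
        dE P Zi Zp (fun ω => (1 - b2r (DiO ω)) * b2r (DpO ω)) true true true false) *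
      (dE P Zi Zp (fun ω => b2r (DiO ω)) false true false false /
        dE P Zi Zp (fun ω => (1 - b2r (DiO ω)) * (1 - b2r (DpO ω))) false true false false))
    (hU : U =
      -(dE P Zi Zp (fun ω => YO ω * (1 - b2r (DiO ω))) false true false false) /
        dE P Zi Zp (fun ω => (1 - b2r (DiO ω)) * (1 - b2r (DpO ω))) false true false false -
      (cexp P (fun ω => YO ω * b2r (DiO ω) * b2r (DpO ω)) (Zev Zi Zp false false) /
        cexp P (fun ω => b2r (DiO ω) * b2r (DpO ω)) (Zev Zi Zp false false)) *
      (dE P Zi Zp (fun ω => b2r (DiO ω)) false true false false /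
        dE P Zi Zp (fun ω => (1 - b2r (DiO ω)) * (1 - b2r (DpO ω))) false true false false)) :
    ((0 < P NC ∧
        cexp P (Y false true) SP ≥ cexp P (Y false true) NC) → L ≤ τ) ∧
    ((0 < P AA ∧
        cexp P (Y true true) AA ≥ cexp P (Y false true) SP) → τ ≤ U) := by
  have hTm : MeasurableSet T := by
    rw [hT]; measurability
  have hSPm : MeasurableSet SP := by
    rw [hSP]; measurability
  have hNCm : MeasurableSet NC := by
    rw [hNC]; measurability
  have hAAm : MeasurableSet AA := by
    rw [hAA]; measurability
  have hpos : ∀ {A : Set Ω}, 0 < P A → 0 < (P A).toReal := fun h =>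
    ENNReal.toReal_pos h.ne' (measure_ne_top _ _)
  have hYdiff : Integrable (fun ω => Y false true ω - Y false false ω) P :=
    (hYint _ _).sub (hYint _ _)
  have hmono : ∀ z, ∀ᵐ ω ∂P, (Dp z false ω = true → Dp z true ω = true) ∧
      (Di z false ω = true → Di z true ω = true) ∧
      (Dp z true ω = Dp z false ω → Di z true ω = Di z false ω) := fun z => by
    filter_upwards [hIV, hSM, hIRR] with ω h1 h2 h3
    exact ⟨(h1 z).2, (h2 z).1, (h3 z).2⟩
  have hYD : dE P Zi Zp (fun ω => YO ω * (1 - b2r (DiO ω))) false true false false =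
      (∫ ω in T, (Y false true ω - Y false false ω) ∂P) - ∫ ω in SP, Y false true ω ∂P := by
    rw [dE_observed hZi hZp hDi hDp hYm hZpos hIndep
      (H := fun p y => y * (1 - b2r p.1)) (fun p => by fun_prop)
      (fun p => (hYint _ _).mul_const _) (fun ω => by simp only [hYO, hDiO, hDpO]),
      ← integral_indicator hTm, ← integral_indicator hSPm, ← integral_sub
        (hYdiff.indicator hTm) ((hYint _ _).indicator hSPm)]
    refine integral_congr_ae ?_
    filter_upwards [hmono false] with ω h
    simp only [Set.indicator_apply, hT, hSP, Set.mem_ofPred_eq]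
    rcases (Di false false ω).eq_false_or_eq_true with e1 | e1 <;>
      rcases (Di false true ω).eq_false_or_eq_true with e2 | e2 <;>
      rcases (Dp false false ω).eq_false_or_eq_true with e3 | e3 <;>
      rcases (Dp false true ω).eq_false_or_eq_true with e4 | e4 <;>
      simp [b2r, e1, e2, e3, e4] at h ⊢
  have hC : dE P Zi Zp (fun ω => (1 - b2r (DiO ω)) * (1 - b2r (DpO ω))) false true false false =
      -(P T).toReal := by
    rw [dE_observed hZi hZp hDi hDp hYm hZpos hIndep
      (H := fun p _ => (1 - b2r p.1) * (1 - b2r p.2)) (fun p => by fun_prop)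
      (fun p => integrable_const _) (fun ω => by simp only [hDiO, hDpO]),
      ← Measure.real, ← integral_indicator_one hTm, ← integral_neg]
    refine integral_congr_ae ?_
    filter_upwards [hmono false] with ω h
    simp only [Set.indicator_apply, hT, Set.mem_ofPred_eq]
    rcases (Di false false ω).eq_false_or_eq_true with e1 | e1 <;>
      rcases (Di false true ω).eq_false_or_eq_true with e2 | e2 <;>
      rcases (Dp false false ω).eq_false_or_eq_true with e3 | e3 <;>
      rcases (Dp false true ω).eq_false_or_eq_true with e4 | e4 <;>
      simp [b2r, e1, e2, e3, e4] at h ⊢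
  have hD : dE P Zi Zp (fun ω => b2r (DiO ω)) false true false false = (P SP).toReal := by
    rw [dE_observed hZi hZp hDi hDp hYm hZpos hIndep
      (H := fun p _ => b2r p.1) (fun p => by fun_prop)
      (fun p => integrable_const _) (fun ω => by simp only [hDiO]),
      ← Measure.real, ← integral_indicator_one hSPm]
    refine integral_congr_ae ?_
    filter_upwards [hmono false] with ω h
    simp only [Set.indicator_apply, hSP, Set.mem_ofPred_eq]
    rcases (Di false false ω).eq_false_or_eq_true with e1 | e1 <;>
      rcases (Di false true ω).eq_false_or_eq_true with e2 | e2 <;>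
      rcases (Dp false false ω).eq_false_or_eq_true with e3 | e3 <;>
      rcases (Dp false true ω).eq_false_or_eq_true with e4 | e4 <;>
      simp [b2r, e1, e2, e3, e4] at h ⊢
  have hN : dE P Zi Zp (fun ω => YO ω * (1 - b2r (DiO ω)) * b2r (DpO ω)) true true true false /
      dE P Zi Zp (fun ω => (1 - b2r (DiO ω)) * b2r (DpO ω)) true true true false =
      cexp P (Y false true) NC := by
    rw [dE_observed hZi hZp hDi hDp hYm hZpos hIndep
      (H := fun p y => y * (1 - b2r p.1) * b2r p.2) (fun p => by fun_prop)
      (fun p => ((hYint _ _).mul_const _).mul_const _)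
      (fun ω => by simp only [hYO, hDiO, hDpO]),
      dE_observed hZi hZp hDi hDp hYm hZpos hIndep
      (H := fun p _ => (1 - b2r p.1) * b2r p.2) (fun p => by fun_prop)
      (fun p => integrable_const _) (fun ω => by simp only [hDiO, hDpO]),
      cexp, ← integral_indicator hNCm, ← Measure.real, ← integral_indicator_one hNCm]
    congr 1 <;> refine integral_congr_ae ?_
    all_goals
      filter_upwards [hmono true] with ω h
      simp only [Set.indicator_apply, hNC, Set.mem_ofPred_eq]
      rcases (Di true false ω).eq_false_or_eq_true with e1 | e1 <;>
        rcases (Di true true ω).eq_false_or_eq_true with e2 | e2 <;>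
        rcases (Dp true false ω).eq_false_or_eq_true with e3 | e3 <;>
        rcases (Dp true true ω).eq_false_or_eq_true with e4 | e4 <;>
        simp [b2r, e1, e2, e3, e4] at h ⊢
  have hA : cexp P (fun ω => YO ω * b2r (DiO ω) * b2r (DpO ω)) (Zev Zi Zp false false) /
      cexp P (fun ω => b2r (DiO ω) * b2r (DpO ω)) (Zev Zi Zp false false) =
      cexp P (Y true true) AA := by
    rw [cexp_Zev_observed hZi hZp hDi hDp hYm hZpos hIndep
      (H := fun p y => y * b2r p.1 * b2r p.2) (fun p => by fun_prop)
      (fun ω => by simp only [hYO, hDiO, hDpO]),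
      cexp_Zev_observed hZi hZp hDi hDp hYm hZpos hIndep
      (H := fun p _ => b2r p.1 * b2r p.2) (fun p => by fun_prop)
      (fun ω => by simp only [hDiO, hDpO]),
      cexp, ← integral_indicator hAAm, ← Measure.real, ← integral_indicator_one hAAm]
    congr 1 <;> refine integral_congr_ae (.of_forall fun ω => ?_)
    all_goals
      simp only [Set.indicator_apply, hAA, Set.mem_ofPred_eq]
      rcases (Di false false ω).eq_false_or_eq_true with e1 | e1 <;>
        rcases (Dp false false ω).eq_false_or_eq_true with e2 | e2 <;>
        simp [b2r, e1, e2]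
  have hTr := hpos hTpos
  have hSPr := hpos hSPpos
  have hSPi : ∫ ω in SP, Y false true ω ∂P = cexp P (Y false true) SP * (P SP).toReal := by
    rw [cexp, div_mul_cancel₀ _ hSPr.ne']
  have hτT : τ = (∫ ω in T, (Y false true ω - Y false false ω) ∂P) / (P T).toReal := hτ
  have hbound : ∀ r, -(dE P Zi Zp (fun ω => YO ω * (1 - b2r (DiO ω))) false true false false) /
        dE P Zi Zp (fun ω => (1 - b2r (DiO ω)) * (1 - b2r (DpO ω))) false true false false -
      r * (dE P Zi Zp (fun ω => b2r (DiO ω)) false true false false /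
        dE P Zi Zp (fun ω => (1 - b2r (DiO ω)) * (1 - b2r (DpO ω))) false true false false) =
      τ + (r - cexp P (Y false true) SP) * ((P SP).toReal / (P T).toReal) := by
    intro r
    rw [hYD, hC, hD, hSPi, hτT]
    field_simp
    ring
  have hratio : 0 ≤ (P SP).toReal / (P T).toReal := by positivity
  rw [hbound, hN] at hL
  rw [hbound, hA] at hU
  refine ⟨fun h => ?_, fun h => ?_⟩
  · have := mul_nonneg (sub_nonneg.2 h.2) hratio
    linarith
  · have := mul_nonneg (sub_nonneg.2 h.2) hratio
    linarith


end
end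

section
/- Partial identification of the direct effect with untreated peers, multiple peers (Theorem 1, part 1). Assume Assumptions IV, SM and IRR hold and P(D_i(1,0) > D_i(0,0), D_{(i)}(0,0) = 0) > 0, so that τ_D(0) = E[Y_i(1,0) − Y_i(0,0) | D_i(1,0) > D_i(0,0), D_{(i)}(0,0) = 0] is well defined. Define L = −Δ^{10}_{00}E[Y_i D_{(i)}^∨] / Δ^{10}_{00}E[D_{i(i)}^∨] + (E[Y_i D_{i(i)}^∨ | Z=(1,1)] / E[D_{i(i)}^∨ | Z=(1,1)]) · (Δ^{10}_{00}E[D_{(i)}^∨] / Δ^{10}_{00}E[D_{i(i)}^∨]) and U = −Δ^{10}_{00}E[Y_i D_{(i)}^∨] / Δ^{10}_{00}E[D_{i(i)}^∨] + (Δ^{01}_{00}E[Y_i D_i D_{(i)}^∨] / Δ^{01}_{00}E[D_i D_{(i)}^∨]) · (Δ^{10}_{00}E[D_{(i)}^∨] / Δ^{10}_{00}E[D_{i(i)}^∨]). Then: (a) if P(D_i(1,1)=0, D_{(i)}(1,1)=0) > 0 and E[Y_i(1,0) | D_i(1,0) > D_i(0,0), D_{(i)}(1,0) ≠ D_{(i)}(0,0)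 = 0] ≥ E[Y_i(0,0) | D_i(1,1)=0, D_{(i)}(1,1)=0], then L ≤ τ_D(0); (b) if P(D_i(0,0)=1, D_{(i)}(0,1) ≠ D_{(i)}(0,0) = 0) > 0 and E[Y_i(1,0) | D_i(0,0)=1, D_{(i)}(0,1) ≠ D_{(i)}(0,0) = 0] ≥ E[Y_i(1,0) | D_i(1,0) > D_i(0,0), D_{(i)}(1,0) ≠ D_{(i)}(0,0) = 0], then τ_D(0) ≤ U. -/
open MeasureTheory ProbabilityTheory

noncomputable section

variable {Ω : Type*} {m : ℕ}

/-- The event `{Z_i = z, Z_{(i)} = z'}` (all peer instruments equal `z'`). -/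
def ZevM (Zi : Ω → Bool) (Zp : Ω → Fin m → Bool) (z z' : Bool) : Set Ω :=
  {ω | Zi ω = z ∧ ∀ j, Zp ω j = z'}

/-- `Δ^{zz'}_{ww'} E[X]`, where `X z z'` is the observed quantity under the
instrument pattern `(z, z')`. -/
def dEM [MeasurableSpace Ω] (P : Measure Ω) (Zi : Ω → Bool) (Zp : Ω → Fin m → Bool)
    (X : Bool → Bool → Ω → ℝ) (z z' w w' : Bool) : ℝ :=
  cexp P (X z z') (ZevM Zi Zp z z') - cexp P (X w w') (ZevM Zi Zp w w')

/-- The indicator that all entries of a Boolean vector are `false`, as a product. -/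
theorem prod_one_sub_b2r (v : Fin m → Bool) :
    ∏ j, (1 - b2r (v j)) = if v = fun _ => false then 1 else 0 := by
  split_ifs with h
  · simp [h, b2r]
  · obtain ⟨j, hj⟩ := Function.ne_iff.mp h
    exact Finset.prod_eq_zero (Finset.mem_univ j) (by simp_all [b2r])

/-- Conditioning on an event of positive probability determined by a variable independent of `X`
does not change the expectation of `X`. -/
theorem cexp_preimage_of_indepFun [MeasurableSpace Ω] {P : Measure Ω} [IsProbabilityMeasure P]
    {α : Type*} [MeasurableSpace α] {V : Ω → α} {X : Ω → ℝ} (hV : Measurable V)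
    (hX : Measurable X) (hind : IndepFun V X P) {S : Set α} (hS : MeasurableSet S)
    (hpos : 0 < P (V ⁻¹' S)) : cexp P X (V ⁻¹' S) = ∫ ω, X ω ∂P := by
  have hind' : IndepFun (fun ω => S.indicator (fun _ => (1 : ℝ)) (V ω)) X P :=
    hind.comp (measurable_const.indicator hS) measurable_id
  have hmeas : Measurable (fun ω => S.indicator (fun _ => (1 : ℝ)) (V ω)) :=
    (measurable_const.indicator hS).comp hV
  have hmul := hind'.integral_fun_mul_eq_mul_integral hmeas.aestronglyMeasurable
    hX.aestronglyMeasurable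
  have hleft : (fun ω => S.indicator (fun _ => (1 : ℝ)) (V ω) * X ω) = (V ⁻¹' S).indicator X := by
    ext ω
    by_cases h : V ω ∈ S <;> simp [h]
  have hright : (fun ω => S.indicator (fun _ => (1 : ℝ)) (V ω)) =
      (V ⁻¹' S).indicator (fun _ => (1 : ℝ)) := rfl
  rw [hleft, hright, integral_indicator (hV hS), integral_indicator (hV hS)] at hmul
  have hne : (P (V ⁻¹' S)).toReal ≠ 0 := (ENNReal.toReal_pos hpos.ne' (measure_ne_top _ _)).ne'
  rw [cexp, hmul]
  simp only [setIntegral_const, smul_eq_mul, mul_one, Measure.real]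
  field_simp

/-- Additivity of the set integral over an almost sure partition into two pieces. -/
theorem setIntegral_eq_add_of_ae_partition [MeasurableSpace Ω] {P : Measure Ω} {f : Ω → ℝ}
    (hf : Integrable f P) {A B C : Set Ω} (hB : MeasurableSet B)
    (h : ∀ᵐ ω ∂P, (ω ∈ C ↔ ω ∈ A ∨ ω ∈ B) ∧ ¬ (ω ∈ A ∧ ω ∈ B)) :
    ∫ ω in C, f ω ∂P = ∫ ω in A, f ω ∂P + ∫ ω in B, f ω ∂P := by
  have hC : C =ᵐ[P] (A ∪ B : Set Ω) := by
    filter_upwards [h] with ω hω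
    exact propext hω.1
  have hd : AEDisjoint P A B := by
    have : ∀ᵐ ω ∂P, ω ∉ A ∩ B := h.mono fun ω hω => hω.2
    exact measure_eq_zero_iff_ae_notMem.mpr this
  rw [setIntegral_congr_set hC]
  exact setIntegral_union₀ hd hB.nullMeasurableSet hf.integrableOn hf.integrableOn

theorem eq_false_of_le {a b : Fin m → Bool} (hab : ∀ j, a j ≤ b j) (hb : b = fun _ => false) :
    a = fun _ => false := by
  ext j
  have := Bool.le_iff_imp.mp (hab j)
  simpa [hb] using this

theorem own_false_partition {α : Type*} {a b : Bool} {p q v : α} (hab : b ≤ a)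
    (h : a = b → p = q) :
    (b = false ∧ q = v ↔ (a = false ∧ p = v) ∨ (a = true ∧ b = false ∧ q = v)) ∧
      ¬ ((a = false ∧ p = v) ∧ (a = true ∧ b = false ∧ q = v)) := by
  rw [Bool.le_iff_imp] at hab
  cases a <;> cases b <;> simp_all

theorem own_true_partition {α : Type*} {a b : Bool} {p q v : α} (hab : b ≤ a)
    (hpq : p = v → q = v) (h : a = b → p = q) :
    (a = true ∧ p = v ↔ (b = true ∧ q = v) ∨ ((a = true ∧ b = false ∧ q = v) ∧ p = v)) ∧
      ¬ ((b = true ∧ q = v) ∧ ((a = true ∧ b = false ∧ q = v) ∧ p = v)) := by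
  rw [Bool.le_iff_imp] at hab
  cases a <;> cases b <;> simp_all

theorem peer_partition {α : Type*} {a b : Bool} {p q v : α}
    (hpq : p = v → q = v) (h : p = q → a = b) :
    (b = true ∧ q = v ↔ (a = true ∧ p = v) ∨ ((b = true ∧ q = v) ∧ ¬ p = v)) ∧
      ¬ ((a = true ∧ p = v) ∧ ((b = true ∧ q = v) ∧ ¬ p = v)) := by
  by_cases hp : p = v <;> grind

/-- The event that the own treatment is `d` and no peer is treated. -/
def untreatedPeers (D : Ω → Bool) (Dv : Ω → Fin m → Bool) (d : Bool) : Set Ω :=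
  {ω | D ω = d ∧ Dv ω = fun _ => false}

theorem measurableSet_untreatedPeers [MeasurableSpace Ω] {D : Ω → Bool} {Dv : Ω → Fin m → Bool}
    (hD : Measurable D) (hDv : Measurable Dv) (d : Bool) :
    MeasurableSet (untreatedPeers D Dv d) :=
  (hD (measurableSet_singleton d)).inter (hDv (measurableSet_singleton _))

/-- The conditional mean of an observed variable supported on the event that no peer is treated,
in terms of its potential values `g`. -/
theorem cexp_ZevM_untreatedPeers [MeasurableSpace Ω] {P : Measure Ω} [IsProbabilityMeasure P]
    {Zi : Ω → Bool} {Zp : Ω → Fin m → Bool} (hZi : Measurable Zi) (hZp : Measurable Zp)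
    {z z' : Bool} (hpos : 0 < P (ZevM Zi Zp z z'))
    {D : Ω → Bool} {Dv : Ω → Fin m → Bool} {g : Bool → Ω → ℝ}
    (hD : Measurable D) (hDv : Measurable Dv)
    (hg : ∀ d, Measurable (g d)) (hgint : ∀ d, Integrable (g d) P)
    (hind : IndepFun (fun ω => (Zi ω, Zp ω)) (fun ω => (D ω, Dv ω, g true ω, g false ω)) P)
    {X : Ω → ℝ} (hX : ∀ ω, X ω = if Dv ω = fun _ => false then g (D ω) ω else 0) :
    cexp P X (ZevM Zi Zp z z') = ∫ ω in untreatedPeers D Dv true, g true ω ∂P +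
      ∫ ω in untreatedPeers D Dv false, g false ω ∂P := by
  have hmN := measurableSet_untreatedPeers hD hDv
  have hXsum : X = fun ω => (untreatedPeers D Dv true).indicator (g true) ω +
      (untreatedPeers D Dv false).indicator (g false) ω := by
    ext ω
    rw [hX]
    by_cases h : Dv ω = fun _ => false <;> cases hd : D ω <;>
      simp [untreatedPeers, Set.indicator, h, hd]
  let φ : Bool × (Fin m → Bool) × ℝ × ℝ → ℝ := fun q =>
    if q.2.1 = fun _ => false then (if q.1 = true then q.2.2.1 else q.2.2.2) else 0
  have hφ : Measurable φ := by
    refine Measurable.ite ?_ (Measurable.ite ?_ (by fun_prop) (by fun_prop)) measurable_const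
    · exact (measurable_fst.comp measurable_snd) (measurableSet_singleton (fun _ => false))
    · exact measurable_fst (measurableSet_singleton true)
  have hXφ : X = φ ∘ fun ω => (D ω, Dv ω, g true ω, g false ω) := by
    ext ω
    rw [hX]
    cases hd : D ω <;> simp [φ, hd]
  have hXm : Measurable X := by
    rw [hXsum]
    exact ((hg true).indicator (hmN true)).add ((hg false).indicator (hmN false))
  have hindX : IndepFun (fun ω => (Zi ω, Zp ω)) X P := by
    rw [hXφ]
    exact hind.comp measurable_id hφ
  have hZ : ZevM Zi Zp z z' = (fun ω => (Zi ω, Zp ω)) ⁻¹' {(z, fun _ => z')} := by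
    ext ω
    simp [ZevM, funext_iff]
  rw [hZ] at hpos ⊢
  rw [cexp_preimage_of_indepFun (hZi.prodMk hZp) hXm hindX (measurableSet_singleton _) hpos,
    hXsum, integral_add ((hgint true).indicator (hmN true))
      ((hgint false).indicator (hmN false)),
    integral_indicator (hmN true), integral_indicator (hmN false)]

/-- Theorem 1, part 1: partial identification of the direct effect `τ_D(0)` with
untreated peers, in the multiple-peers setting. -/
theorem direct_effect_untreated_peers_multiple
    [MeasurableSpace Ω] (P : Measure Ω) [IsProbabilityMeasure P]
    (m : ℕ) (hm : 1 ≤ m)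
    (Zi : Ω → Bool) (Zp : Ω → Fin m → Bool)
    (Di : Bool → Bool → Ω → Bool) (Dp : Bool → Bool → Ω → Fin m → Bool)
    (Y : Bool → (Fin m → Bool) → Ω → ℝ)
    (hZi : Measurable Zi) (hZp : Measurable Zp)
    (hDi : ∀ z z', Measurable (Di z z')) (hDp : ∀ z z', Measurable (Dp z z'))
    (hYm : ∀ d dp, Measurable (Y d dp)) (hYint : ∀ d dp, Integrable (Y d dp) P)
    (hZpos : ∀ z z', 0 < P (ZevM Zi Zp z z'))
    -- Assumption IV: independence and own-instrument monotonicity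
    (hIndep : IndepFun (fun ω => (Zi ω, Zp ω))
      (fun ω => (fun z z' => Di z z' ω, fun z z' => Dp z z' ω,
        fun d dp => Y d dp ω)) P)
    (hIV : ∀ᵐ ω ∂P, (∀ z, Di false z ω ≤ Di true z ω) ∧
      ∀ zi j, Dp zi false ω j ≤ Dp zi true ω j)
    -- Assumption SM: monotonicity in the spillovers
    (hSM : ∀ᵐ ω ∂P, (∀ zi, Di zi false ω ≤ Di zi true ω) ∧
      ∀ z j, Dp false z ω j ≤ Dp true z ω j)
    -- Assumption IRR: irrelevance
    (hIRR : ∀ᵐ ω ∂P, (∀ z, Di true z ω = Di false z ω → Dp true z ω = Dp false z ω) ∧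
      ∀ zi, Dp zi true ω = Dp zi false ω → Di zi true ω = Di zi false ω)
    -- the event {D_i(1,0) > D_i(0,0), D_{(i)}(0,0) = 0} and τ_D(0)
    (T : Set Ω)
    (hT : T = {ω | Di true false ω = true ∧ Di false false ω = false ∧
      ∀ j, Dp false false ω j = false})
    (hTpos : 0 < P T)
    -- the event {D_i(1,0) > D_i(0,0), D_{(i)}(1,0) ≠ D_{(i)}(0,0) = 0}
    (SC : Set Ω)
    (hSC : SC = {ω | Di true false ω = true ∧ Di false false ω = false ∧
      Dp true false ω ≠ Dp false false ω ∧ ∀ j, Dp false false ω j = false})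
    (hSCpos : 0 < P SC)
    -- the event {D_i(1,1)=0, D_{(i)}(1,1)=0}
    (NN : Set Ω)
    (hNN : NN = {ω | Di true true ω = false ∧ ∀ j, Dp true true ω j = false})
    -- the event {D_i(0,0)=1, D_{(i)}(0,1) ≠ D_{(i)}(0,0) = 0}
    (AC : Set Ω)
    (hAC : AC = {ω | Di false false ω = true ∧
      Dp false true ω ≠ Dp false false ω ∧ ∀ j, Dp false false ω j = false})
    (τ L U : ℝ)
    (hτ : τ = cexp P
      (fun ω => Y true (fun _ => false) ω - Y false (fun _ => false) ω) T)
    (hL : L =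
      -(dEM P Zi Zp (fun z z' ω => Y (Di z z' ω) (Dp z z' ω) ω *
          ∏ j, (1 - b2r (Dp z z' ω j))) true false false false) /
        dEM P Zi Zp (fun z z' ω => (1 - b2r (Di z z' ω)) *
          ∏ j, (1 - b2r (Dp z z' ω j))) true false false false +
      (cexp P (fun ω => Y (Di true true ω) (Dp true true ω) ω *
          ((1 - b2r (Di true true ω)) * ∏ j, (1 - b2r (Dp true true ω j))))
          (ZevM Zi Zp true true) /
        cexp P (fun ω => (1 - b2r (Di true true ω)) *
          ∏ j, (1 - b2r (Dp true true ω j))) (ZevM Zi Zp true true)) *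
      (dEM P Zi Zp (fun z z' ω => ∏ j, (1 - b2r (Dp z z' ω j))) true false false false /
        dEM P Zi Zp (fun z z' ω => (1 - b2r (Di z z' ω)) *
          ∏ j, (1 - b2r (Dp z z' ω j))) true false false false))
    (hU : U =
      -(dEM P Zi Zp (fun z z' ω => Y (Di z z' ω) (Dp z z' ω) ω *
          ∏ j, (1 - b2r (Dp z z' ω j))) true false false false) /
        dEM P Zi Zp (fun z z' ω => (1 - b2r (Di z z' ω)) *
          ∏ j, (1 - b2r (Dp z z' ω j))) true false false false +
      (dEM P Zi Zp (fun z z' ω => Y (Di z z' ω) (Dp z z' ω) ω * (b2r (Di z z' ω) *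
          ∏ j, (1 - b2r (Dp z z' ω j)))) false true false false /
        dEM P Zi Zp (fun z z' ω => b2r (Di z z' ω) *
          ∏ j, (1 - b2r (Dp z z' ω j))) false true false false) *
      (dEM P Zi Zp (fun z z' ω => ∏ j, (1 - b2r (Dp z z' ω j))) true false false false /
        dEM P Zi Zp (fun z z' ω => (1 - b2r (Di z z' ω)) *
          ∏ j, (1 - b2r (Dp z z' ω j))) true false false false)) :
    ((0 < P NN ∧
        cexp P (Y true (fun _ => false)) SC ≥ cexp P (Y false (fun _ => false)) NN) →
      L ≤ τ) ∧
    ((0 < P AC ∧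
        cexp P (Y true (fun _ => false)) AC ≥ cexp P (Y true (fun _ => false)) SC) →
      τ ≤ U) := by
  obtain ⟨v, hv⟩ : ∃ v : Fin m → Bool, v = fun _ => false := ⟨_, rfl⟩
  let N : Bool → Bool → Bool → Set Ω := fun z z' => untreatedPeers (Di z z') (Dp z z')
  have hobsY : ∀ (w : Bool → ℝ) (z z' : Bool) (X : Ω → ℝ),
      (∀ ω, X ω = Y (Di z z' ω) (Dp z z' ω) ω *
        (w (Di z z' ω) * ∏ j, (1 - b2r (Dp z z' ω j)))) →
      cexp P X (ZevM Zi Zp z z') = w true * ∫ ω in N z z' true, Y true v ω ∂P +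
        w false * ∫ ω in N z z' false, Y false v ω ∂P := by
    intro w z z' X hX
    rw [← integral_const_mul, ← integral_const_mul]
    refine cexp_ZevM_untreatedPeers (g := fun d ω => w d * Y d v ω) hZi hZp (hZpos z z')
      (hDi z z') (hDp z z') (fun d => (hYm d v).const_mul _) (fun d => (hYint d v).const_mul _)
      ?_ ?_
    · have hφ : Measurable (fun q : (Bool → Bool → Bool) × (Bool → Bool → Fin m → Bool) ×
          (Bool → (Fin m → Bool) → ℝ) =>
          (q.1 z z', q.2.1 z z', w true * q.2.2 true v, w false * q.2.2 false v)) := by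
        fun_prop
      exact hIndep.comp measurable_id hφ
    · intro ω
      rw [hX, prod_one_sub_b2r]
      split_ifs with h
      · rw [h, hv]
        ring
      · ring
  have hobs : ∀ (w : Bool → ℝ) (z z' : Bool) (X : Ω → ℝ),
      (∀ ω, X ω = w (Di z z' ω) * ∏ j, (1 - b2r (Dp z z' ω j))) →
      cexp P X (ZevM Zi Zp z z') = w true * P.real (N z z' true) +
        w false * P.real (N z z' false) := by
    intro w z z' X hX
    have hconst : ∀ d, w d * P.real (N z z' d) = ∫ ω in N z z' d, w d ∂P := by
      intro d
      rw [setIntegral_const, smul_eq_mul, mul_comm]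
    rw [hconst, hconst]
    refine cexp_ZevM_untreatedPeers (g := fun d _ => w d) hZi hZp (hZpos z z')
      (hDi z z') (hDp z z') (fun d => measurable_const) (fun d => integrable_const _) ?_ ?_
    · have hφ : Measurable (fun q : (Bool → Bool → Bool) × (Bool → Bool → Fin m → Bool) ×
          (Bool → (Fin m → Bool) → ℝ) => (q.1 z z', q.2.1 z z', w true, w false)) := by
        fun_prop
      exact hIndep.comp measurable_id hφ
    · intro ω
      rw [hX, prod_one_sub_b2r]
      split_ifs with h
      · ring
      · ring
  -- Almost sure decompositions of the events with untreated peers.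
  have hmN : ∀ z z' d, MeasurableSet (N z z' d) := fun z z' d =>
    measurableSet_untreatedPeers (hDi z z') (hDp z z') d
  let Q : Set Ω := T ∩ (Dp true false) ⁻¹' {v}
  have hT' : T = (Di true false) ⁻¹' {true} ∩ N false false false := by
    rw [hT]
    ext ω
    simp [N, untreatedPeers, funext_iff]
  have hSC' : SC = T ∩ ((Dp true false) ⁻¹' {v})ᶜ := by
    rw [hT, hSC]
    ext ω
    have e : (∀ j, Dp false false ω j = false) ↔ Dp false false ω = v := by
      simp [hv, funext_iff]
    simp only [Set.mem_ofPred_eq, Set.mem_inter_iff, Set.mem_compl_iff, Set.mem_preimage,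
      Set.mem_singleton_iff, e]
    constructor
    · rintro ⟨h1, h2, h3, h4⟩
      exact ⟨⟨h1, h2, h4⟩, h4 ▸ h3⟩
    · rintro ⟨⟨h1, h2, h4⟩, h3⟩
      exact ⟨h1, h2, h4.symm ▸ h3, h4⟩
  have hNN' : NN = N true true false := by
    rw [hNN]
    ext ω
    simp [N, untreatedPeers, funext_iff]
  have hAC' : AC = N false false true ∩ ((Dp false true) ⁻¹' {v})ᶜ := by
    rw [hAC]
    ext ω
    have e : (∀ j, Dp false false ω j = false) ↔ Dp false false ω = v := by
      simp [hv, funext_iff]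
    simp only [N, untreatedPeers, ← hv, Set.mem_ofPred_eq, Set.mem_inter_iff, Set.mem_compl_iff,
      Set.mem_preimage, Set.mem_singleton_iff, e]
    constructor
    · rintro ⟨h1, h2, h3⟩
      exact ⟨⟨h1, h3⟩, h3 ▸ h2⟩
    · rintro ⟨⟨h1, h3⟩, h2⟩
      exact ⟨h1, h3.symm ▸ h2, h3⟩
  have hmV : ∀ z z', MeasurableSet ((Dp z z') ⁻¹' {v}) := fun z z' =>
    hDp z z' (measurableSet_singleton v)
  have hmT : MeasurableSet T := by
    rw [hT']
    exact (hDi true false (measurableSet_singleton true)).inter (hmN _ _ _)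
  have hmSC : MeasurableSet SC := by
    rw [hSC']
    exact hmT.inter (hmV _ _).compl
  have hmAC : MeasurableSet AC := by
    rw [hAC']
    exact (hmN _ _ _).inter (hmV _ _).compl
  have hmQ : MeasurableSet Q := hmT.inter (hmV _ _)
  have hdecT : ∀ f : Ω → ℝ, Integrable f P →
      ∫ ω in T, f ω ∂P = ∫ ω in Q, f ω ∂P + ∫ ω in SC, f ω ∂P := by
    intro f hf
    refine setIntegral_eq_add_of_ae_partition hf hmSC (Filter.Eventually.of_forall fun ω => ?_)
    simp only [hSC', Q, Set.mem_inter_iff, Set.mem_compl_iff]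
    tauto
  have hdecN : ∀ f : Ω → ℝ, Integrable f P →
      ∫ ω in N false false false, f ω ∂P =
        ∫ ω in N true false false, f ω ∂P + ∫ ω in T, f ω ∂P := by
    intro f hf
    refine setIntegral_eq_add_of_ae_partition hf hmT ?_
    filter_upwards [hIV, hIRR] with ω h1 h3
    rw [hT']
    exact own_false_partition (h1.1 false) (h3.1 false)
  have hdecA : ∀ f : Ω → ℝ, Integrable f P →
      ∫ ω in N true false true, f ω ∂P =
        ∫ ω in N false false true, f ω ∂P + ∫ ω in Q, f ω ∂P := by
    intro f hf
    refine setIntegral_eq_add_of_ae_partition hf hmQ ?_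
    filter_upwards [hIV, hSM, hIRR] with ω h1 h2 h3
    simp only [Q, hT', hv]
    exact own_true_partition (h1.1 false) (eq_false_of_le (h2.2 false)) (h3.1 false)
  have hdecC : ∀ f : Ω → ℝ, Integrable f P →
      ∫ ω in N false false true, f ω ∂P =
        ∫ ω in N false true true, f ω ∂P + ∫ ω in AC, f ω ∂P := by
    intro f hf
    refine setIntegral_eq_add_of_ae_partition hf hmAC ?_
    filter_upwards [hIV, hIRR] with ω h1 h3
    rw [hAC', hv]
    exact peer_partition (eq_false_of_le (h1.2 false)) (h3.2 false)
  have hone : ∀ A : Set Ω, ∫ _ in A, (1 : ℝ) ∂P = P.real A := fun A => by simp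
  have hint1 : Integrable (fun _ : Ω => (1 : ℝ)) P := integrable_const _
  have pT := hdecT _ hint1
  have pN := hdecN _ hint1
  have pA := hdecA _ hint1
  have pC := hdecC _ hint1
  simp only [hone] at pT pN pA pC
  -- Identification of the estimands.
  have eY : dEM P Zi Zp (fun z z' ω => Y (Di z z' ω) (Dp z z' ω) ω *
      ∏ j, (1 - b2r (Dp z z' ω j))) true false false false =
      ∫ ω in T, Y true v ω ∂P - ∫ ω in SC, Y true v ω ∂P - ∫ ω in T, Y false v ω ∂P := by
    rw [dEM, hobsY (fun _ => 1) true false _ (fun ω => by ring),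
      hobsY (fun _ => 1) false false _ (fun ω => by ring)]
    linarith [hdecT _ (hYint true v), hdecA _ (hYint true v), hdecN _ (hYint false v)]
  have eD : dEM P Zi Zp (fun z z' ω => (1 - b2r (Di z z' ω)) *
      ∏ j, (1 - b2r (Dp z z' ω j))) true false false false = - P.real T := by
    rw [dEM, hobs (fun d => 1 - b2r d) true false _ (fun ω => rfl),
      hobs (fun d => 1 - b2r d) false false _ (fun ω => rfl)]
    simp only [b2r, if_true, Bool.false_eq_true, if_false]
    linarith
  have eV : dEM P Zi Zp (fun z z' ω => ∏ j, (1 - b2r (Dp z z' ω j))) true false false false =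
      - P.real SC := by
    rw [dEM, hobs (fun _ => 1) true false _ (fun ω => by ring),
      hobs (fun _ => 1) false false _ (fun ω => by ring)]
    linarith
  have eNY : cexp P (fun ω => Y (Di true true ω) (Dp true true ω) ω *
      ((1 - b2r (Di true true ω)) * ∏ j, (1 - b2r (Dp true true ω j))))
      (ZevM Zi Zp true true) = ∫ ω in NN, Y false v ω ∂P := by
    rw [hobsY (fun d => 1 - b2r d) true true _ (fun ω => rfl), hNN']
    simp [b2r]
  have eND : cexp P (fun ω => (1 - b2r (Di true true ω)) *
      ∏ j, (1 - b2r (Dp true true ω j))) (ZevM Zi Zp true true) = P.real NN := by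
    rw [hobs (fun d => 1 - b2r d) true true _ (fun ω => rfl), hNN']
    simp [b2r]
  have eAY : dEM P Zi Zp (fun z z' ω => Y (Di z z' ω) (Dp z z' ω) ω * (b2r (Di z z' ω) *
      ∏ j, (1 - b2r (Dp z z' ω j)))) false true false false = - ∫ ω in AC, Y true v ω ∂P := by
    rw [dEM, hobsY b2r false true _ (fun ω => rfl), hobsY b2r false false _ (fun ω => rfl)]
    simp only [b2r, if_true, Bool.false_eq_true, if_false]
    linarith [hdecC _ (hYint true v)]
  have eAD : dEM P Zi Zp (fun z z' ω => b2r (Di z z' ω) *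
      ∏ j, (1 - b2r (Dp z z' ω j))) false true false false = - P.real AC := by
    rw [dEM, hobs b2r false true _ (fun ω => rfl), hobs b2r false false _ (fun ω => rfl)]
    simp only [b2r, if_true, Bool.false_eq_true, if_false]
    linarith
  rw [eY, eD, eV, eNY, eND] at hL
  rw [eY, eD, eV, eAY, eAD] at hU
  rw [← hv] at hτ ⊢
  have hτ' : τ = (∫ ω in T, Y true v ω ∂P - ∫ ω in T, Y false v ω ∂P) / P.real T := by
    rw [hτ, cexp, integral_sub (hYint _ _).integrableOn (hYint _ _).integrableOn]
    rfl
  have hT0 : 0 < P.real T := ENNReal.toReal_pos hTpos.ne' (measure_ne_top _ _)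
  have hSC0 : 0 < P.real SC := ENNReal.toReal_pos hSCpos.ne' (measure_ne_top _ _)
  have hr : 0 ≤ P.real SC / P.real T := by positivity
  have hbase : -(∫ ω in T, Y true v ω ∂P - ∫ ω in SC, Y true v ω ∂P -
      ∫ ω in T, Y false v ω ∂P) / -P.real T =
      τ - cexp P (Y true v) SC * (P.real SC / P.real T) := by
    rw [hτ', cexp, ← Measure.real]
    field_simp
    ring
  rw [hbase, neg_div_neg_eq] at hL
  rw [hbase, neg_div_neg_eq, neg_div_neg_eq] at hU
  constructor
  · rintro ⟨-, h⟩
    have hc : (∫ ω in NN, Y false v ω ∂P) / P.real NN = cexp P (Y false v) NN := rfl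
    rw [hL, hc]
    linarith [mul_le_mul_of_nonneg_right h hr]
  · rintro ⟨-, h⟩
    have hc : (∫ ω in AC, Y true v ω ∂P) / P.real AC = cexp P (Y true v) AC := rfl
    rw [hU, hc]
    linarith [mul_le_mul_of_nonneg_right h hr]

end
end

section
/- Partial identification of the direct effect with treated peers, multiple peers (Theorem 1, part 2). Assume Assumptions IV, SM and IRR hold and P(D_i(1,1) > D_i(0,1), D_{(i)}(1,1) = 1) > 0, so that τ_D(1) = E[Y_i(1,1) − Y_i(0,1) | D_i(1,1) > D_i(0,1), D_{(i)}(1,1) = 1] is well defined. Define L = Δ^{11}_{01}E[Y_i D_{(i)}^∧] / Δ^{11}_{01}E[D_{i(i)}^∧] − (E[Y_i D_{i(i)}^∧ | Z=(0,0)] / E[D_{i(i)}^∧ | Z=(0,0)]) · (Δ^{11}_{01}E[D_{(i)}^∧] / Δ^{11}_{01}E[D_{i(i)}^∧]) and U = Δ^{11}_{01}E[Y_i D_{(i)}^∧] / Δ^{11}_{01}E[D_{i(i)}^∧] − (Δ^{11}_{10}E[Y_i(1−D_i)D_{(i)}^∧] / Δ^{11}_{10}E[(1−D_i)D_{(i)}^∧])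 · (Δ^{11}_{01}E[D_{(i)}^∧] / Δ^{11}_{01}E[D_{i(i)}^∧]). Then: (a) if P(D_i(0,0)=1, D_{(i)}(0,0)=1) > 0 and E[Y_i(1,1) | D_i(0,0)=1, D_{(i)}(0,0)=1] ≥ E[Y_i(0,1) | D_i(1,1) > D_i(0,1), D_{(i)}(0,1) ≠ D_{(i)}(1,1) = 1], then L ≤ τ_D(1); (b) if P(D_i(1,1)=0, D_{(i)}(1,0) ≠ D_{(i)}(1,1) = 1) > 0 and E[Y_i(0,1) | D_i(1,1) > D_i(0,1), D_{(i)}(0,1) ≠ D_{(i)}(1,1) = 1] ≥ E[Y_i(0,1) | D_i(1,1)=0, D_{(i)}(1,0) ≠ D_{(i)}(1,1) = 1], then τ_D(1) ≤ U. -/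
open MeasureTheory ProbabilityTheory

noncomputable section

variable {Ω : Type*} {m : ℕ}

lemma prod_b2r_eq_ite (p : Fin m → Bool) :
    ∏ j, b2r (p j) = if ∀ j, p j = true then 1 else 0 := by
  simp only [b2r, Finset.prod_ite_zero, Finset.mem_univ, true_imp_iff, Finset.prod_const_one]

/-- Conditioning on an event about `Z` does not affect the mean of a function of a variable
independent of `Z`. -/
lemma cexp_comp_of_indepFun {α β : Type*} [MeasurableSpace Ω] [MeasurableSpace α]
    [MeasurableSpace β] {P : Measure Ω} [IsFiniteMeasure P] {Z : Ω → α} {V : Ω → β}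
    (hZ : Measurable Z) (hV : Measurable V) (h : IndepFun Z V P) {S : Set α}
    (hS : MeasurableSet S) (hpos : 0 < P (Z ⁻¹' S)) {f : β → ℝ} (hf : Measurable f) :
    cexp P (fun ω => f (V ω)) (Z ⁻¹' S) = ∫ ω, f (V ω) ∂P := by
  have hg : Measurable (S.indicator (fun _ => (1 : ℝ))) := measurable_const.indicator hS
  have key : ∫ ω, S.indicator (fun _ => (1 : ℝ)) (Z ω) * f (V ω) ∂P =
      (∫ ω, S.indicator (fun _ => (1 : ℝ)) (Z ω) ∂P) * ∫ ω, f (V ω) ∂P :=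
    (h.comp hg hf).integral_fun_mul_eq_mul_integral (hg.comp hZ).aestronglyMeasurable
      (hf.comp hV).aestronglyMeasurable
  have h1 : (fun ω => S.indicator (fun _ => (1 : ℝ)) (Z ω)) =
      (Z ⁻¹' S).indicator (fun _ => (1 : ℝ)) := rfl
  have h2 : (fun ω => S.indicator (fun _ => (1 : ℝ)) (Z ω) * f (V ω)) =
      (Z ⁻¹' S).indicator (fun ω => f (V ω)) := by
    ext ω
    by_cases hω : Z ω ∈ S <;> simp [hω]
  rw [h1, h2, integral_indicator (hZ hS), integral_indicator (hZ hS), setIntegral_const] at key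
  have hne : (P (Z ⁻¹' S)).toReal ≠ 0 := (ENNReal.toReal_pos hpos.ne' (measure_ne_top _ _)).ne'
  rw [cexp, key, Measure.real, smul_eq_mul, mul_one, mul_div_cancel_left₀ _ hne]

lemma mul_b2r_mul_prod_b2r (d : Bool) (p : Fin m → Bool) (y : Bool → (Fin m → Bool) → ℝ) :
    y d p * (b2r d * ∏ j, b2r (p j)) =
      if d = true ∧ ∀ j, p j = true then y true (fun _ => true) else 0 := by
  rw [prod_b2r_eq_ite]
  by_cases hp : ∀ j, p j = true
  · obtain rfl : p = fun _ => true := funext hp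
    cases d <;> simp [b2r]
  · simp [hp]

lemma forall_eq_true_of_le {p q : Fin m → Bool} (h : ∀ j, p j ≤ q j) (hp : ∀ j, p j = true) :
    ∀ j, q j = true :=
  fun j => Bool.eq_true_of_true_le (hp j ▸ h j)

/-- If the own treatment and the peer treatments are monotone in an instrument, and the peers
respond only when the individual does, then a contrast restricted to fully treated peers splits
into a direct effect of the own treatment and a contribution of the responding peers. -/
lemma own_shift_eq {d₀ d₁ : Bool} {p₀ p₁ : Fin m → Bool} (hd : d₀ ≤ d₁)
    (hp : ∀ j, p₀ j ≤ p₁ j) (hirr : d₁ = d₀ → p₁ = p₀) (y : Bool → (Fin m → Bool) → ℝ) :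
    y d₁ p₁ * ∏ j, b2r (p₁ j) - y d₀ p₀ * ∏ j, b2r (p₀ j) =
      (if d₁ = true ∧ d₀ = false ∧ ∀ j, p₁ j = true then
        y true (fun _ => true) - y false (fun _ => true) else 0) +
      if d₁ = true ∧ d₀ = false ∧ p₀ ≠ p₁ ∧ ∀ j, p₁ j = true then
        y false (fun _ => true) else 0 := by
  have hmono := forall_eq_true_of_le hp
  rw [prod_b2r_eq_ite, prod_b2r_eq_ite]
  by_cases hdd : d₁ = d₀
  · obtain rfl := hirr hdd
    subst hdd
    cases d₁ <;> simp
  · obtain ⟨rfl, rfl⟩ : d₁ = true ∧ d₀ = false := by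
      revert hd hdd; cases d₀ <;> cases d₁ <;> simp
    by_cases h₁ : ∀ j, p₁ j = true
    · obtain rfl : p₁ = fun _ => true := funext h₁
      by_cases h₀ : ∀ j, p₀ j = true
      · obtain rfl : p₀ = fun _ => true := funext h₀
        simp
      · have hne : p₀ ≠ fun _ => true := fun h => h₀ fun j => congrFun h j
        simp [h₀, hne]
    · have h₀ : ¬ ∀ j, p₀ j = true := fun h => h₁ (hmono h)
      simp [h₀, h₁]

/-- If the own treatment and the peer treatments are monotone in an instrument, and the
individual responds only when some peer does, then a contrast restricted to fully treated peers
of an untreated individual only involves the responding peers of never treated individuals. -/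
lemma peer_shift_eq {d₀ d₁ : Bool} {p₀ p₁ : Fin m → Bool} (hd : d₀ ≤ d₁)
    (hp : ∀ j, p₀ j ≤ p₁ j) (hirr : p₁ = p₀ → d₁ = d₀) (y : Bool → (Fin m → Bool) → ℝ) :
    y d₁ p₁ * ((1 - b2r d₁) * ∏ j, b2r (p₁ j)) - y d₀ p₀ * ((1 - b2r d₀) * ∏ j, b2r (p₀ j)) =
      if d₁ = false ∧ p₀ ≠ p₁ ∧ ∀ j, p₁ j = true then y false (fun _ => true) else 0 := by
  have hmono := forall_eq_true_of_le hp
  rw [prod_b2r_eq_ite, prod_b2r_eq_ite]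
  by_cases h₀ : ∀ j, p₀ j = true
  · obtain rfl : p₁ = p₀ := funext fun j => (hmono h₀ j).trans (h₀ j).symm
    obtain rfl := hirr rfl
    simp
  · by_cases h₁ : ∀ j, p₁ j = true
    · have hne : p₀ ≠ p₁ := fun h => h₀ (h ▸ h₁)
      obtain rfl : p₁ = fun _ => true := funext h₁
      cases d₁ <;> simp [h₀, hne, b2r]
    · simp [h₀, h₁]

lemma measurable_eval_pair :
    Measurable (fun x : (Bool × (Fin m → Bool)) × (Bool → (Fin m → Bool) → ℝ) =>
      x.2 x.1.1 x.1.2) :=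
  measurable_from_prod_countable_right fun i =>
    (measurable_pi_apply i.2).comp (measurable_pi_apply i.1)

/-- The vector of all potential treatments and potential outcomes. -/
def potentials (Di : Bool → Bool → Ω → Bool) (Dp : Bool → Bool → Ω → Fin m → Bool)
    (Y : Bool → (Fin m → Bool) → Ω → ℝ) (ω : Ω) :
    (Bool → Bool → Bool) × (Bool → Bool → Fin m → Bool) × (Bool → (Fin m → Bool) → ℝ) :=
  (fun z z' => Di z z' ω, fun z z' => Dp z z' ω, fun d dp => Y d dp ω)

section

variable [MeasurableSpace Ω] {P : Measure Ω}
  {Zi : Ω → Bool} {Zp : Ω → Fin m → Bool}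
  {Di : Bool → Bool → Ω → Bool} {Dp : Bool → Bool → Ω → Fin m → Bool}
  {Y : Bool → (Fin m → Bool) → Ω → ℝ}

lemma measurable_potentials (hDi : ∀ z z', Measurable (Di z z'))
    (hDp : ∀ z z', Measurable (Dp z z')) (hYm : ∀ d dp, Measurable (Y d dp)) :
    Measurable (potentials Di Dp Y) := by
  refine Measurable.prodMk ?_ (Measurable.prodMk ?_ ?_)
  · exact measurable_pi_lambda _ fun z => measurable_pi_lambda _ fun z' => hDi z z'
  · exact measurable_pi_lambda _ fun z => measurable_pi_lambda _ fun z' => hDp z z'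
  · exact measurable_pi_lambda _ fun d => measurable_pi_lambda _ fun dp => hYm d dp

/-- Under independence, the mean of an observed quantity given an instrument pattern is the
mean of its potential counterpart. -/
lemma cexp_observed [IsProbabilityMeasure P] (hZi : Measurable Zi) (hZp : Measurable Zp)
    (hDi : ∀ z z', Measurable (Di z z')) (hDp : ∀ z z', Measurable (Dp z z'))
    (hYm : ∀ d dp, Measurable (Y d dp))
    (hIndep : IndepFun (fun ω => (Zi ω, Zp ω)) (potentials Di Dp Y) P)
    (φ : Bool → (Fin m → Bool) → ℝ) (z z' : Bool) (hpos : 0 < P (ZevM Zi Zp z z')) :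
    cexp P (fun ω => Y (Di z z' ω) (Dp z z' ω) ω * φ (Di z z' ω) (Dp z z' ω))
      (ZevM Zi Zp z z') =
      ∫ ω, Y (Di z z' ω) (Dp z z' ω) ω * φ (Di z z' ω) (Dp z z' ω) ∂P := by
  have hev : ZevM Zi Zp z z' =
      (fun ω => (Zi ω, Zp ω)) ⁻¹' {x | x.1 = z ∧ ∀ j, x.2 j = z'} := rfl
  have hφ : Measurable (fun x : Bool × (Fin m → Bool) => φ x.1 x.2) := measurable_of_countable _
  let f : (Bool → Bool → Bool) × (Bool → Bool → Fin m → Bool) ×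
      (Bool → (Fin m → Bool) → ℝ) → ℝ :=
    fun v => v.2.2 (v.1 z z') (v.2.1 z z') * φ (v.1 z z') (v.2.1 z z')
  have hD : Measurable (fun v : (Bool → Bool → Bool) × (Bool → Bool → Fin m → Bool) ×
      (Bool → (Fin m → Bool) → ℝ) => (v.1 z z', v.2.1 z z')) := by fun_prop
  have hf : Measurable f :=
    (measurable_eval_pair.comp (hD.prodMk measurable_snd.snd)).mul (hφ.comp hD)
  rw [hev] at hpos ⊢
  exact cexp_comp_of_indepFun (hZi.prodMk hZp) (measurable_potentials hDi hDp hYm) hIndep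
    (Set.toFinite _).measurableSet hpos hf

lemma integrable_observed (hDi : ∀ z z', Measurable (Di z z'))
    (hDp : ∀ z z', Measurable (Dp z z'))
    (hYm : ∀ d dp, Measurable (Y d dp)) (hYint : ∀ d dp, Integrable (Y d dp) P)
    (φ : Bool → (Fin m → Bool) → ℝ) (z z' : Bool) :
    Integrable (fun ω => Y (Di z z' ω) (Dp z z' ω) ω * φ (Di z z' ω) (Dp z z' ω)) P := by
  have hφ : Measurable (fun x : Bool × (Fin m → Bool) => φ x.1 x.2) := measurable_of_countable _
  have hD : Measurable (fun ω => (Di z z' ω, Dp z z' ω)) := (hDi z z').prodMk (hDp z z')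
  have hm : Measurable (fun ω => Y (Di z z' ω) (Dp z z' ω) ω * φ (Di z z' ω) (Dp z z' ω)) :=
    (measurable_eval_pair.comp
      (hD.prodMk (measurable_potentials hDi hDp hYm).snd.snd)).mul (hφ.comp hD)
  have hsum : Integrable (fun ω => ∑ x : Bool × (Fin m → Bool), ‖Y x.1 x.2 ω * φ x.1 x.2‖) P :=
    integrable_finsetSum _ fun x _ => ((hYint x.1 x.2).mul_const _).norm
  refine hsum.mono' hm.aestronglyMeasurable (Filter.Eventually.of_forall fun ω => ?_)
  exact Finset.single_le_sum
    (f := fun x : Bool × (Fin m → Bool) => ‖Y x.1 x.2 ω * φ x.1 x.2‖)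
    (fun _ _ => norm_nonneg _) (Finset.mem_univ (Di z z' ω, Dp z z' ω))

lemma dEM_observed_eq_integral [IsProbabilityMeasure P] (hZi : Measurable Zi) (hZp : Measurable Zp)
    (hDi : ∀ z z', Measurable (Di z z')) (hDp : ∀ z z', Measurable (Dp z z'))
    (hYm : ∀ d dp, Measurable (Y d dp)) (hYint : ∀ d dp, Integrable (Y d dp) P)
    (hZpos : ∀ z z', 0 < P (ZevM Zi Zp z z'))
    (hIndep : IndepFun (fun ω => (Zi ω, Zp ω)) (potentials Di Dp Y) P)
    (φ : Bool → (Fin m → Bool) → ℝ) (z z' w w' : Bool) {g : Ω → ℝ}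
    (hg : ∀ᵐ ω ∂P, Y (Di z z' ω) (Dp z z' ω) ω * φ (Di z z' ω) (Dp z z' ω) -
      Y (Di w w' ω) (Dp w w' ω) ω * φ (Di w w' ω) (Dp w w' ω) = g ω) :
    dEM P Zi Zp (fun z z' ω => Y (Di z z' ω) (Dp z z' ω) ω * φ (Di z z' ω) (Dp z z' ω))
      z z' w w' = ∫ ω, g ω ∂P := by
  rw [dEM, cexp_observed hZi hZp hDi hDp hYm hIndep φ z z' (hZpos z z'),
    cexp_observed hZi hZp hDi hDp hYm hIndep φ w w' (hZpos w w'),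
    ← integral_sub (integrable_observed hDi hDp hYm hYint φ z z')
      (integrable_observed hDi hDp hYm hYint φ w w')]
  exact integral_congr_ae hg

lemma indepFun_potentials_one (hIndep : IndepFun (fun ω => (Zi ω, Zp ω)) (potentials Di Dp Y) P) :
    IndepFun (fun ω => (Zi ω, Zp ω)) (potentials Di Dp fun _ _ _ => (1 : ℝ)) P :=
  hIndep.comp (φ := id)
    (ψ := fun v : (Bool → Bool → Bool) × (Bool → Bool → Fin m → Bool) ×
      (Bool → (Fin m → Bool) → ℝ) => (v.1, v.2.1, fun _ _ => (1 : ℝ)))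
    measurable_id (by fun_prop)

lemma cexp_treatment [IsProbabilityMeasure P] (hZi : Measurable Zi) (hZp : Measurable Zp)
    (hDi : ∀ z z', Measurable (Di z z')) (hDp : ∀ z z', Measurable (Dp z z'))
    (hIndep : IndepFun (fun ω => (Zi ω, Zp ω)) (potentials Di Dp Y) P)
    (φ : Bool → (Fin m → Bool) → ℝ) (z z' : Bool) (hpos : 0 < P (ZevM Zi Zp z z')) :
    cexp P (fun ω => φ (Di z z' ω) (Dp z z' ω)) (ZevM Zi Zp z z') =
      ∫ ω, φ (Di z z' ω) (Dp z z' ω) ∂P := by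
  simpa only [one_mul] using cexp_observed (Y := fun _ _ _ => 1) hZi hZp hDi hDp
    (fun _ _ => measurable_const) (indepFun_potentials_one hIndep) φ z z' hpos

lemma dEM_treatment_eq_integral [IsProbabilityMeasure P] (hZi : Measurable Zi) (hZp : Measurable Zp)
    (hDi : ∀ z z', Measurable (Di z z')) (hDp : ∀ z z', Measurable (Dp z z'))
    (hZpos : ∀ z z', 0 < P (ZevM Zi Zp z z'))
    (hIndep : IndepFun (fun ω => (Zi ω, Zp ω)) (potentials Di Dp Y) P)
    (φ : Bool → (Fin m → Bool) → ℝ) (z z' w w' : Bool) {g : Ω → ℝ}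
    (hg : ∀ᵐ ω ∂P, φ (Di z z' ω) (Dp z z' ω) - φ (Di w w' ω) (Dp w w' ω) = g ω) :
    dEM P Zi Zp (fun z z' ω => φ (Di z z' ω) (Dp z z' ω)) z z' w w' = ∫ ω, g ω ∂P := by
  have h := dEM_observed_eq_integral (Y := fun _ _ _ => 1) hZi hZp hDi hDp
    (fun _ _ => measurable_const) (fun _ _ => integrable_const _) hZpos
    (indepFun_potentials_one hIndep) φ z z' w w' (g := g) (by simpa only [one_mul] using hg)
  simpa only [one_mul] using h

end

/-- Theorem 1, part 2: partial identification of the direct effect `τ_D(1)` with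
treated peers, in the multiple-peers setting. -/
theorem direct_effect_treated_peers_multiple
    [MeasurableSpace Ω] (P : Measure Ω) [IsProbabilityMeasure P]
    (m : ℕ) (hm : 1 ≤ m)
    (Zi : Ω → Bool) (Zp : Ω → Fin m → Bool)
    (Di : Bool → Bool → Ω → Bool) (Dp : Bool → Bool → Ω → Fin m → Bool)
    (Y : Bool → (Fin m → Bool) → Ω → ℝ)
    (hZi : Measurable Zi) (hZp : Measurable Zp)
    (hDi : ∀ z z', Measurable (Di z z')) (hDp : ∀ z z', Measurable (Dp z z'))
    (hYm : ∀ d dp, Measurable (Y d dp)) (hYint : ∀ d dp, Integrable (Y d dp) P)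
    (hZpos : ∀ z z', 0 < P (ZevM Zi Zp z z'))
    -- Assumption IV: independence and own-instrument monotonicity
    (hIndep : IndepFun (fun ω => (Zi ω, Zp ω))
      (fun ω => (fun z z' => Di z z' ω, fun z z' => Dp z z' ω,
        fun d dp => Y d dp ω)) P)
    (hIV : ∀ᵐ ω ∂P, (∀ z, Di false z ω ≤ Di true z ω) ∧
      ∀ zi j, Dp zi false ω j ≤ Dp zi true ω j)
    -- Assumption SM: monotonicity in the spillovers
    (hSM : ∀ᵐ ω ∂P, (∀ zi, Di zi false ω ≤ Di zi true ω) ∧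
      ∀ z j, Dp false z ω j ≤ Dp true z ω j)
    -- Assumption IRR: irrelevance
    (hIRR : ∀ᵐ ω ∂P, (∀ z, Di true z ω = Di false z ω → Dp true z ω = Dp false z ω) ∧
      ∀ zi, Dp zi true ω = Dp zi false ω → Di zi true ω = Di zi false ω)
    -- the event {D_i(1,1) > D_i(0,1), D_{(i)}(1,1) = 1} and τ_D(1)
    (T : Set Ω)
    (hT : T = {ω | Di true true ω = true ∧ Di false true ω = false ∧
      ∀ j, Dp true true ω j = true})
    (hTpos : 0 < P T)
    -- the event {D_i(1,1) > D_i(0,1), D_{(i)}(0,1) ≠ D_{(i)}(1,1) = 1}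
    (CG : Set Ω)
    (hCG : CG = {ω | Di true true ω = true ∧ Di false true ω = false ∧
      Dp false true ω ≠ Dp true true ω ∧ ∀ j, Dp true true ω j = true})
    (hCGpos : 0 < P CG)
    -- the event {D_i(0,0)=1, D_{(i)}(0,0)=1}
    (AA : Set Ω)
    (hAA : AA = {ω | Di false false ω = true ∧ ∀ j, Dp false false ω j = true})
    -- the event {D_i(1,1)=0, D_{(i)}(1,0) ≠ D_{(i)}(1,1) = 1}
    (NC : Set Ω)
    (hNC : NC = {ω | Di true true ω = false ∧
      Dp true false ω ≠ Dp true true ω ∧ ∀ j, Dp true true ω j = true})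
    (τ L U : ℝ)
    (hτ : τ = cexp P
      (fun ω => Y true (fun _ => true) ω - Y false (fun _ => true) ω) T)
    (hL : L =
      dEM P Zi Zp (fun z z' ω => Y (Di z z' ω) (Dp z z' ω) ω *
          ∏ j, b2r (Dp z z' ω j)) true true false true /
        dEM P Zi Zp (fun z z' ω => b2r (Di z z' ω) *
          ∏ j, b2r (Dp z z' ω j)) true true false true -
      (cexp P (fun ω => Y (Di false false ω) (Dp false false ω) ω *
          (b2r (Di false false ω) * ∏ j, b2r (Dp false false ω j)))
          (ZevM Zi Zp false false) /
        cexp P (fun ω => b2r (Di false false ω) *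
          ∏ j, b2r (Dp false false ω j)) (ZevM Zi Zp false false)) *
      (dEM P Zi Zp (fun z z' ω => ∏ j, b2r (Dp z z' ω j)) true true false true /
        dEM P Zi Zp (fun z z' ω => b2r (Di z z' ω) *
          ∏ j, b2r (Dp z z' ω j)) true true false true))
    (hU : U =
      dEM P Zi Zp (fun z z' ω => Y (Di z z' ω) (Dp z z' ω) ω *
          ∏ j, b2r (Dp z z' ω j)) true true false true /
        dEM P Zi Zp (fun z z' ω => b2r (Di z z' ω) *
          ∏ j, b2r (Dp z z' ω j)) true true false true -
      (dEM P Zi Zp (fun z z' ω => Y (Di z z' ω) (Dp z z' ω) ω *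
          ((1 - b2r (Di z z' ω)) * ∏ j, b2r (Dp z z' ω j))) true true true false /
        dEM P Zi Zp (fun z z' ω => (1 - b2r (Di z z' ω)) *
          ∏ j, b2r (Dp z z' ω j)) true true true false) *
      (dEM P Zi Zp (fun z z' ω => ∏ j, b2r (Dp z z' ω j)) true true false true /
        dEM P Zi Zp (fun z z' ω => b2r (Di z z' ω) *
          ∏ j, b2r (Dp z z' ω j)) true true false true)) :
    ((0 < P AA ∧
        cexp P (Y true (fun _ => true)) AA ≥ cexp P (Y false (fun _ => true)) CG) →
      L ≤ τ) ∧
    ((0 < P NC ∧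
        cexp P (Y false (fun _ => true)) CG ≥ cexp P (Y false (fun _ => true)) NC) →
      τ ≤ U) := by
  have hI : IndepFun (fun ω => (Zi ω, Zp ω)) (potentials Di Dp Y) P := hIndep
  have hmDi : ∀ z z' d, MeasurableSet {ω | Di z z' ω = d} := fun z z' d =>
    hDi z z' (measurableSet_singleton d)
  have hmDp : ∀ z z', MeasurableSet {ω | ∀ j, Dp z z' ω j = true} := fun z z' =>
    hDp z z' (Set.toFinite {p : Fin m → Bool | ∀ j, p j = true}).measurableSet
  have hmNe : ∀ z z' w w', MeasurableSet {ω | Dp z z' ω ≠ Dp w w' ω} := fun z z' w w' =>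
    (measurableSet_eq_fun (hDp z z') (hDp w w')).compl
  have hTm : MeasurableSet T := by
    rw [hT]; exact (hmDi _ _ _).inter ((hmDi _ _ _).inter (hmDp _ _))
  have hCGm : MeasurableSet CG := by
    rw [hCG]; exact (hmDi _ _ _).inter ((hmDi _ _ _).inter ((hmNe _ _ _ _).inter (hmDp _ _)))
  have hAAm : MeasurableSet AA := by
    rw [hAA]; exact (hmDi _ _ _).inter (hmDp _ _)
  have hNCm : MeasurableSet NC := by
    rw [hNC]; exact (hmDi _ _ _).inter ((hmNe _ _ _ _).inter (hmDp _ _))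
  have hYT : dEM P Zi Zp (fun z z' ω => Y (Di z z' ω) (Dp z z' ω) ω *
      ∏ j, b2r (Dp z z' ω j)) true true false true =
      (∫ ω in T, (Y true (fun _ => true) ω - Y false (fun _ => true) ω) ∂P) +
        ∫ ω in CG, Y false (fun _ => true) ω ∂P := by
    rw [← integral_indicator hTm, ← integral_indicator hCGm, ← integral_add
      (f := T.indicator fun ω => Y true (fun _ => true) ω - Y false (fun _ => true) ω)
      (((hYint _ _).sub (hYint _ _)).indicator hTm) ((hYint _ _).indicator hCGm)]
    refine dEM_observed_eq_integral hZi hZp hDi hDp hYm hYint hZpos hI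
      (fun _ p => ∏ j, b2r (p j)) _ _ _ _ ?_
    filter_upwards [hIV, hSM, hIRR] with ω h1 h2 h3
    have h := own_shift_eq (h1.1 true) (h2.2 true) (h3.1 true) (fun d p => Y d p ω)
    simpa [hT, hCG, Set.indicator_apply, b2r] using h
  have hDT : dEM P Zi Zp (fun z z' ω => b2r (Di z z' ω) * ∏ j, b2r (Dp z z' ω j))
      true true false true = (P T).toReal := by
    rw [← Measure.real, ← integral_indicator_one hTm]
    refine dEM_treatment_eq_integral hZi hZp hDi hDp hZpos hI
      (fun d p => b2r d * ∏ j, b2r (p j)) _ _ _ _ ?_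
    filter_upwards [hIV, hSM, hIRR] with ω h1 h2 h3
    have h := own_shift_eq (h1.1 true) (h2.2 true) (h3.1 true) (fun d _ => b2r d)
    simpa [hT, hCG, Set.indicator_apply, b2r] using h
  have hWCG : dEM P Zi Zp (fun z z' ω => ∏ j, b2r (Dp z z' ω j)) true true false true =
      (P CG).toReal := by
    rw [← Measure.real, ← integral_indicator_one hCGm]
    refine dEM_treatment_eq_integral hZi hZp hDi hDp hZpos hI
      (fun _ p => ∏ j, b2r (p j)) _ _ _ _ ?_
    filter_upwards [hIV, hSM, hIRR] with ω h1 h2 h3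
    have h := own_shift_eq (h1.1 true) (h2.2 true) (h3.1 true) (fun _ _ => 1)
    simpa [hT, hCG, Set.indicator_apply, b2r] using h
  have hYAA : cexp P (fun ω => Y (Di false false ω) (Dp false false ω) ω *
      (b2r (Di false false ω) * ∏ j, b2r (Dp false false ω j))) (ZevM Zi Zp false false) =
      ∫ ω in AA, Y true (fun _ => true) ω ∂P := by
    rw [← integral_indicator hAAm, cexp_observed hZi hZp hDi hDp hYm hI
      (fun d p => b2r d * ∏ j, b2r (p j)) false false (hZpos _ _)]
    congr 1 with ω
    simpa [hAA, Set.indicator_apply] using mul_b2r_mul_prod_b2r (Di false false ω) (Dp false false ω)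
      (fun d p => Y d p ω)
  have hDAA : cexp P (fun ω => b2r (Di false false ω) * ∏ j, b2r (Dp false false ω j))
      (ZevM Zi Zp false false) = (P AA).toReal := by
    rw [← Measure.real, ← integral_indicator_one hAAm, cexp_treatment hZi hZp hDi hDp hI
      (fun d p => b2r d * ∏ j, b2r (p j)) false false (hZpos _ _)]
    congr 1 with ω
    simpa [hAA, Set.indicator_apply] using mul_b2r_mul_prod_b2r (Di false false ω) (Dp false false ω)
      (fun _ _ => 1)
  have hYNC : dEM P Zi Zp (fun z z' ω => Y (Di z z' ω) (Dp z z' ω) ω *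
      ((1 - b2r (Di z z' ω)) * ∏ j, b2r (Dp z z' ω j))) true true true false =
      ∫ ω in NC, Y false (fun _ => true) ω ∂P := by
    rw [← integral_indicator hNCm]
    refine dEM_observed_eq_integral hZi hZp hDi hDp hYm hYint hZpos hI
      (fun d p => (1 - b2r d) * ∏ j, b2r (p j)) _ _ _ _ ?_
    filter_upwards [hIV, hSM, hIRR] with ω h1 h2 h3
    have h := peer_shift_eq (h2.1 true) (h1.2 true) (h3.2 true) (fun d p => Y d p ω)
    simpa [hNC, Set.indicator_apply] using h
  have hDNC : dEM P Zi Zp (fun z z' ω => (1 - b2r (Di z z' ω)) * ∏ j, b2r (Dp z z' ω j))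
      true true true false = (P NC).toReal := by
    rw [← Measure.real, ← integral_indicator_one hNCm]
    refine dEM_treatment_eq_integral hZi hZp hDi hDp hZpos hI
      (fun d p => (1 - b2r d) * ∏ j, b2r (p j)) _ _ _ _ ?_
    filter_upwards [hIV, hSM, hIRR] with ω h1 h2 h3
    have h := peer_shift_eq (h2.1 true) (h1.2 true) (h3.2 true) (fun _ _ => 1)
    simpa [hNC, Set.indicator_apply] using h
  rw [hYT, hDT, hWCG, hYAA, hDAA] at hL
  rw [hYT, hDT, hWCG, hYNC, hDNC] at hU
  have hCG0 : (P CG).toReal ≠ 0 := (ENNReal.toReal_pos hCGpos.ne' (measure_ne_top _ _)).ne'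
  have hratio : 0 ≤ (P CG).toReal / (P T).toReal := by positivity
  have hsplit : ((∫ ω in T, (Y true (fun _ => true) ω - Y false (fun _ => true) ω) ∂P) +
      ∫ ω in CG, Y false (fun _ => true) ω ∂P) / (P T).toReal =
      τ + cexp P (Y false fun _ => true) CG * ((P CG).toReal / (P T).toReal) := by
    rw [hτ, cexp, cexp, div_mul_div_cancel₀ hCG0, add_div]
  rw [hsplit] at hL hU
  refine ⟨fun h => ?_, fun h => ?_⟩
  · have := mul_le_mul_of_nonneg_right h.2 hratio
    rw [hL]
    simp only [cexp] at this ⊢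
    linarith
  · have := mul_le_mul_of_nonneg_right h.2 hratio
    rw [hU]
    simp only [cexp] at this ⊢
    linarith

end
end

section
/- Partial identification of the spillover effect on treated individuals under one-sided noncompliance (Theorem 2, part 2). Assume Assumptions IV, SM, IRR and OSNC hold and P(D_i(1,1) = 1, D_{(i)}(1,1) ≠ 0) > 0, so that τ_S(1) = E[Y_i(1, D_{(i)}(1,1)) − Y_i(1,0) | D_i(1,1) = 1, D_{(i)}(1,1) ≠ 0] is well defined. Define L = Δ^{11}_{10}E[Y_i D_i] / Δ^{11}_{10}E[D_i(1 − D_{(i)}^∨)] − (Δ^{11}_{10}E[Y_i D_i D_{(i)}^∨] / Δ^{11}_{10}E[D_i D_{(i)}^∨]) · (Δ^{11}_{10}E[D_i] / Δ^{11}_{10}E[D_i(1 − D_{(i)}^∨)]) and U = Δ^{11}_{10}E[Y_i D_i] / Δ^{11}_{10}E[D_i(1 − D_{(i)}^∨)] − (E[Y_i D_{i(i)}^∨ | Z=(1,1)] / E[D_{i(i)}^∨ | Z=(1,1)]) · (Δ^{11}_{10}E[D_i] / Δ^{11}_{10}E[D_i(1 − D_{(i)}^∨)]). Then: (a) if P(D_i(1,1)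 = D_i(1,0) = 1, D_{(i)}(1,1) ≠ 0) > 0 and E[Y_i(1,0) | D_i(1,1) = D_i(1,0) = 1, D_{(i)}(1,1) ≠ 0] ≥ E[Y_i(1,0) | D_i(1,1) > D_i(1,0), D_{(i)}(1,1) ≠ 0], then L ≤ τ_S(1); (b) if P(D_i(1,1)=0, D_{(i)}(1,1)=0) > 0 and E[Y_i(1,0) | D_i(1,1) > D_i(1,0), D_{(i)}(1,1) ≠ 0] ≥ E[Y_i(0,0) | D_i(1,1)=0, D_{(i)}(1,1)=0], then τ_S(1) ≤ U. -/
open MeasureTheory ProbabilityTheory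

noncomputable section

variable {Ω : Type*} {m : ℕ}

@[simp]
lemma b2r_true : b2r true = 1 := rfl

@[simp]
lemma b2r_false : b2r false = 0 := rfl

/-- The product of the complements of finitely many indicators is the indicator that all vanish. -/
lemma prod_one_sub_b2r_s7 {ι : Type*} [Fintype ι] (x : ι → Bool) [Decidable (∀ j, x j = false)] :
    ∏ j, (1 - b2r (x j)) = if ∀ j, x j = false then (1 : ℝ) else 0 := by
  split_ifs with h
  · simp [h, b2r]
  · push Not at h
    obtain ⟨j, hj⟩ := h
    refine Finset.prod_eq_zero (Finset.mem_univ j) ?_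
    simp_all [b2r]

/-- Selecting from a finite family of functions is a sum of indicators. -/
lemma apply_eq_sum_indicator {α ι : Type*} [Fintype ι] (k : α → ι) (X : ι → α → ℝ) :
    (fun a => X (k a) a) = fun a => ∑ i, (k ⁻¹' {i}).indicator (X i) a := by
  classical
  funext a
  simp [Set.indicator_apply]

lemma measurable_apply_of_finite {α ι : Type*} [MeasurableSpace α] [Fintype ι]
    [MeasurableSpace ι] [MeasurableSingletonClass ι] {k : α → ι} {X : ι → α → ℝ}
    (hk : Measurable k) (hX : ∀ i, Measurable (X i)) : Measurable fun a => X (k a) a := by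
  rw [apply_eq_sum_indicator]
  exact Finset.measurable_sum _ fun i _ => (hX i).indicator (hk (measurableSet_singleton i))

lemma integrable_apply_of_finite {α ι : Type*} [MeasurableSpace α] {μ : Measure α} [Fintype ι]
    [MeasurableSpace ι] [MeasurableSingletonClass ι] {k : α → ι} {X : ι → α → ℝ}
    (hk : Measurable k) (hX : ∀ i, Integrable (X i) μ) : Integrable (fun a => X (k a) a) μ := by
  rw [apply_eq_sum_indicator]
  exact integrable_finsetSum _ fun i _ => (hX i).indicator (hk (measurableSet_singleton i))

lemma measurableSet_ZevM [MeasurableSpace Ω] {Zi : Ω → Bool} {Zp : Ω → Fin m → Bool}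
    (hZi : Measurable Zi) (hZp : Measurable Zp) (z z' : Bool) :
    MeasurableSet (ZevM Zi Zp z z') := by
  have h : ZevM Zi Zp z z' = Zi ⁻¹' {z} ∩ Zp ⁻¹' {fun _ => z'} := by
    ext ω
    simp [ZevM, funext_iff]
  rw [h]
  exact (hZi (measurableSet_singleton _)).inter (hZp (measurableSet_singleton _))

/-- Conditioning a function of `V` on an instrument event independent of `V` has no effect. -/
lemma cexp_ZevM_of_indepFun [MeasurableSpace Ω] {P : Measure Ω} [IsProbabilityMeasure P]
    {β : Type*} [MeasurableSpace β] {Zi : Ω → Bool} {Zp : Ω → Fin m → Bool} {V : Ω → β}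
    (hZi : Measurable Zi) (hZp : Measurable Zp) (hV : Measurable V)
    (hInd : IndepFun (fun ω => (Zi ω, Zp ω)) V P) {z z' : Bool}
    (hpos : 0 < P (ZevM Zi Zp z z')) {F : β → ℝ} (hF : Measurable F) :
    cexp P (fun ω => F (V ω)) (ZevM Zi Zp z z') = ∫ ω, F (V ω) ∂P := by
  classical
  have hA := measurableSet_ZevM hZi hZp z z'
  let f : Bool × (Fin m → Bool) → ℝ := fun x => if x = (z, fun _ => z') then 1 else 0
  have hf : (fun ω => f (Zi ω, Zp ω)) = (ZevM Zi Zp z z').indicator 1 := by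
    funext ω
    simp [f, ZevM, Set.indicator_apply, funext_iff]
  have hfm : Measurable f := measurable_of_countable f
  have hi := (hInd.comp hfm hF).integral_fun_mul_eq_mul_integral
    (hfm.comp (hZi.prodMk hZp)).aestronglyMeasurable (hF.comp hV).aestronglyMeasurable
  simp only [Function.comp_apply] at hi
  have h1 : ∫ ω, f (Zi ω, Zp ω) ∂P = (P (ZevM Zi Zp z z')).toReal := by
    rw [hf, integral_indicator_one hA, Measure.real]
  have h2 : ∫ ω, f (Zi ω, Zp ω) * F (V ω) ∂P = ∫ ω in ZevM Zi Zp z z', F (V ω) ∂P := by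
    rw [← integral_indicator hA]
    congr 1
    funext ω
    rw [show f (Zi ω, Zp ω) = _ from congrFun hf ω]
    by_cases h : ω ∈ ZevM Zi Zp z z' <;> simp [h]
  rw [cexp, ← h2, hi, h1, mul_div_cancel_left₀]
  exact (ENNReal.toReal_pos hpos.ne' (measure_ne_top _ _)).ne'

/-- Theorem 2, part 2: partial identification of the spillover effect `τ_S(1)` on
treated individuals under one-sided noncompliance, multiple peers. -/
theorem spillover_effect_treated_osnc
    [MeasurableSpace Ω] (P : Measure Ω) [IsProbabilityMeasure P]
    (m : ℕ) (hm : 1 ≤ m)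
    (Zi : Ω → Bool) (Zp : Ω → Fin m → Bool)
    (Di : Bool → Bool → Ω → Bool) (Dp : Bool → Bool → Ω → Fin m → Bool)
    (Y : Bool → (Fin m → Bool) → Ω → ℝ)
    (hZi : Measurable Zi) (hZp : Measurable Zp)
    (hDi : ∀ z z', Measurable (Di z z')) (hDp : ∀ z z', Measurable (Dp z z'))
    (hYm : ∀ d dp, Measurable (Y d dp)) (hYint : ∀ d dp, Integrable (Y d dp) P)
    (hZpos : ∀ z z', 0 < P (ZevM Zi Zp z z'))
    -- Assumption IV: independence and own-instrument monotonicity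
    (hIndep : IndepFun (fun ω => (Zi ω, Zp ω))
      (fun ω => (fun z z' => Di z z' ω, fun z z' => Dp z z' ω,
        fun d dp => Y d dp ω)) P)
    (hIV : ∀ᵐ ω ∂P, (∀ z, Di false z ω ≤ Di true z ω) ∧
      ∀ zi j, Dp zi false ω j ≤ Dp zi true ω j)
    -- Assumption SM: monotonicity in the spillovers
    (hSM : ∀ᵐ ω ∂P, (∀ zi, Di zi false ω ≤ Di zi true ω) ∧
      ∀ z j, Dp false z ω j ≤ Dp true z ω j)
    -- Assumption IRR: irrelevance
    (hIRR : ∀ᵐ ω ∂P, (∀ z, Di true z ω = Di false z ω → Dp true z ω = Dp false z ω) ∧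
      ∀ zi, Dp zi true ω = Dp zi false ω → Di zi true ω = Di zi false ω)
    -- Assumption OSNC: one-sided noncompliance
    (hOSNC : ∀ᵐ ω ∂P, (∀ z, Di false z ω = false) ∧
      ∀ zi j, Dp zi false ω j = false)
    -- the event {D_i(1,1) = 1, D_{(i)}(1,1) ≠ 0} and τ_S(1)
    (T : Set Ω)
    (hT : T = {ω | Di true true ω = true ∧ ∃ j, Dp true true ω j = true})
    (hTpos : 0 < P T)
    -- the event {D_i(1,1) = D_i(1,0) = 1, D_{(i)}(1,1) ≠ 0}
    (C : Set Ω)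
    (hC : C = {ω | Di true true ω = true ∧ Di true false ω = true ∧
      ∃ j, Dp true true ω j = true})
    -- the event {D_i(1,1) > D_i(1,0), D_{(i)}(1,1) ≠ 0}
    (G : Set Ω)
    (hG : G = {ω | Di true true ω = true ∧ Di true false ω = false ∧
      ∃ j, Dp true true ω j = true})
    (hGpos : 0 < P G)
    -- the event {D_i(1,1)=0, D_{(i)}(1,1)=0}
    (NN : Set Ω)
    (hNN : NN = {ω | Di true true ω = false ∧ ∀ j, Dp true true ω j = false})
    (τ L U : ℝ)
    (hτ : τ = cexp P
      (fun ω => Y true (Dp true true ω) ω - Y true (fun _ => false) ω) T)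
    (hL : L =
      dEM P Zi Zp (fun z z' ω => Y (Di z z' ω) (Dp z z' ω) ω *
          b2r (Di z z' ω)) true true true false /
        dEM P Zi Zp (fun z z' ω => b2r (Di z z' ω) *
          (1 - ∏ j, (1 - b2r (Dp z z' ω j)))) true true true false -
      (dEM P Zi Zp (fun z z' ω => Y (Di z z' ω) (Dp z z' ω) ω * (b2r (Di z z' ω) *
          ∏ j, (1 - b2r (Dp z z' ω j)))) true true true false /
        dEM P Zi Zp (fun z z' ω => b2r (Di z z' ω) *
          ∏ j, (1 - b2r (Dp z z' ω j))) true true true false) *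
      (dEM P Zi Zp (fun z z' ω => b2r (Di z z' ω)) true true true false /
        dEM P Zi Zp (fun z z' ω => b2r (Di z z' ω) *
          (1 - ∏ j, (1 - b2r (Dp z z' ω j)))) true true true false))
    (hU : U =
      dEM P Zi Zp (fun z z' ω => Y (Di z z' ω) (Dp z z' ω) ω *
          b2r (Di z z' ω)) true true true false /
        dEM P Zi Zp (fun z z' ω => b2r (Di z z' ω) *
          (1 - ∏ j, (1 - b2r (Dp z z' ω j)))) true true true false -
      (cexp P (fun ω => Y (Di true true ω) (Dp true true ω) ω *
          ((1 - b2r (Di true true ω)) * ∏ j, (1 - b2r (Dp true true ω j))))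
          (ZevM Zi Zp true true) /
        cexp P (fun ω => (1 - b2r (Di true true ω)) *
          ∏ j, (1 - b2r (Dp true true ω j))) (ZevM Zi Zp true true)) *
      (dEM P Zi Zp (fun z z' ω => b2r (Di z z' ω)) true true true false /
        dEM P Zi Zp (fun z z' ω => b2r (Di z z' ω) *
          (1 - ∏ j, (1 - b2r (Dp z z' ω j)))) true true true false)) :
    ((0 < P C ∧
        cexp P (Y true (fun _ => false)) C ≥ cexp P (Y true (fun _ => false)) G) →
      L ≤ τ) ∧
    ((0 < P NN ∧
        cexp P (Y true (fun _ => false)) G ≥ cexp P (Y false (fun _ => false)) NN) →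
      τ ≤ U) := by
  classical
  have hV : Measurable (fun ω => ((fun z z' => Di z z' ω, fun z z' => Dp z z' ω,
      fun d dp => Y d dp ω) : (Bool → Bool → Bool) × (Bool → Bool → Fin m → Bool) ×
        (Bool → (Fin m → Bool) → ℝ))) := by
    refine Measurable.prodMk ?_ (Measurable.prodMk ?_ ?_) <;>
    · refine measurable_pi_lambda _ fun a => measurable_pi_lambda _ fun b => ?_
      first
        | exact hDi a b
        | exact hDp a b
        | exact hYm a b
  have hobs (Ψ : Bool → (Fin m → Bool) → ℝ → ℝ) (hΨ : ∀ d dp, Measurable (Ψ d dp))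
      (z z' : Bool) :
      cexp P (fun ω => Ψ (Di z z' ω) (Dp z z' ω) (Y (Di z z' ω) (Dp z z' ω) ω))
        (ZevM Zi Zp z z') =
      ∫ ω, Ψ (Di z z' ω) (Dp z z' ω) (Y (Di z z' ω) (Dp z z' ω) ω) ∂P := by
    refine cexp_ZevM_of_indepFun hZi hZp hV hIndep (hZpos z z')
      (F := fun x => Ψ (x.1 z z') (x.2.1 z z') (x.2.2 (x.1 z z') (x.2.1 z z'))) ?_
    refine measurable_apply_of_finite
      (k := fun x : (Bool → Bool → Bool) × (Bool → Bool → Fin m → Bool) ×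
        (Bool → (Fin m → Bool) → ℝ) => (x.1 z z', x.2.1 z z'))
      (X := fun i x => Ψ i.1 i.2 (x.2.2 i.1 i.2)) (by fun_prop) fun i => ?_
    exact (hΨ i.1 i.2).comp (by fun_prop)
  have hint (Ψ : Bool → (Fin m → Bool) → ℝ → ℝ)
      (hΨ : ∀ d dp, Integrable (fun ω => Ψ d dp (Y d dp ω)) P) (z z' : Bool) :
      Integrable (fun ω => Ψ (Di z z' ω) (Dp z z' ω) (Y (Di z z' ω) (Dp z z' ω) ω)) P :=
    integrable_apply_of_finite (k := fun ω => (Di z z' ω, Dp z z' ω))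
      (X := fun i ω => Ψ i.1 i.2 (Y i.1 i.2 ω)) ((hDi z z').prodMk (hDp z z'))
      fun i => hΨ i.1 i.2
  have hΔ (Ψ : Bool → (Fin m → Bool) → ℝ → ℝ) (hΨ : ∀ d dp, Measurable (Ψ d dp))
      (hΨi : ∀ d dp, Integrable (fun ω => Ψ d dp (Y d dp ω)) P) :
      dEM P Zi Zp (fun z z' ω => Ψ (Di z z' ω) (Dp z z' ω) (Y (Di z z' ω) (Dp z z' ω) ω))
        true true true false =
      ∫ ω, (Ψ (Di true true ω) (Dp true true ω) (Y (Di true true ω) (Dp true true ω) ω) -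
        Ψ (Di true false ω) (Dp true false ω) (Y (Di true false ω) (Dp true false ω) ω)) ∂P := by
    rw [integral_sub (hint Ψ hΨi true true) (hint Ψ hΨi true false), dEM, hobs Ψ hΨ, hobs Ψ hΨ]
  have hda : MeasurableSet {ω | Di true true ω = true} :=
    hDi true true (measurableSet_singleton true)
  have hdb : MeasurableSet {ω | Di true false ω = true} :=
    hDi true false (measurableSet_singleton true)
  have hv : MeasurableSet {ω | ∀ j, Dp true true ω j = false} := by
    have h := hDp true true (measurableSet_singleton fun _ => false)
    have he : {ω | ∀ j, Dp true true ω j = false} =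
        Dp true true ⁻¹' {fun _ => false} := by
      ext ω
      simp [funext_iff]
    rwa [he]
  have hTe : T = {ω | Di true true ω = true} ∩ {ω | ∀ j, Dp true true ω j = false}ᶜ := by
    ext ω; simp [hT]
  have hCe : C = T ∩ {ω | Di true false ω = true} := by
    ext ω; simp only [hT, hC, Set.mem_ofPred_eq, Set.mem_inter_iff]; tauto
  have hGe : G = T \ {ω | Di true false ω = true} := by
    ext ω
    simp only [hT, hG, Set.mem_ofPred_eq, Set.mem_sdiff, Bool.not_eq_true]; tauto
  have hNe : NN = {ω | Di true true ω = true}ᶜ ∩ {ω | ∀ j, Dp true true ω j = false} := by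
    ext ω; simp [hNN]
  have hTm : MeasurableSet T := hTe ▸ hda.inter hv.compl
  have hCm : MeasurableSet C := hCe ▸ hTm.inter hdb
  have hGm : MeasurableSet G := hGe ▸ hTm.diff hdb
  have hNm : MeasurableSet NN := hNe ▸ hda.compl.inter hv
  have hY1 : Integrable (fun ω => Y true (Dp true true ω) ω) P :=
    integrable_apply_of_finite (hDp true true) fun dp => hYint true dp
  have hY0 : Integrable (Y true fun _ => false) P := hYint _ _
  have hreg : ∀ᵐ ω ∂P, Dp true false ω = (fun _ => false) ∧
      (Di true true ω = true ∧ Di true false ω = true ∧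
          (∏ j, (1 - b2r (Dp true true ω j)) = 0) ∧ ω ∈ T ∧ ω ∈ C ∧ ω ∉ G ∧ ω ∉ NN ∨
        Di true true ω = true ∧ Di true false ω = false ∧
          (∏ j, (1 - b2r (Dp true true ω j)) = 0) ∧ ω ∈ T ∧ ω ∉ C ∧ ω ∈ G ∧ ω ∉ NN ∨
        Di true true ω = false ∧ Di true false ω = false ∧
          (∏ j, (1 - b2r (Dp true true ω j)) = 0) ∧ ω ∉ T ∧ ω ∉ C ∧ ω ∉ G ∧ ω ∉ NN ∨
        Di true true ω = true ∧ Di true false ω = true ∧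
          Dp true true ω = (fun _ => false) ∧ ω ∉ T ∧ ω ∉ C ∧ ω ∉ G ∧ ω ∉ NN ∨
        Di true true ω = false ∧ Di true false ω = false ∧
          Dp true true ω = (fun _ => false) ∧ ω ∉ T ∧ ω ∉ C ∧ ω ∉ G ∧ ω ∈ NN) := by
    filter_upwards [hSM, hIRR, hOSNC] with ω h1 h2 h3
    have h0 : Dp true false ω = fun _ => false := funext (h3.2 true)
    have hle : Di true false ω = true → Di true true ω = true := fun h =>
      top_le_iff.mp (h.symm.le.trans (h1.1 true))
    have heq := h2.2 true
    refine ⟨h0, ?_⟩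
    rw [h0] at heq
    clear h1 h2 h3
    simp only [hT, hC, hG, hNN, Set.mem_ofPred_eq, prod_one_sub_b2r_s7]
    by_cases hd : ∀ j, Dp true true ω j = false
    · have hd' := heq (funext hd)
      cases ha : Di true true ω <;> simp [ha, ← hd', hd, funext_iff]
    · have hd' : ∃ j, Dp true true ω j = true := by simpa using hd
      cases ha : Di true true ω <;> cases hb : Di true false ω <;>
        simp [ha, hb, hd, hd'] at hle ⊢
  have hpT : (P T).toReal = ∫ ω, T.indicator 1 ω ∂P := by
    rw [integral_indicator_one hTm, Measure.real]
  have hpC : (P C).toReal = ∫ ω, C.indicator 1 ω ∂P := by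
    rw [integral_indicator_one hCm, Measure.real]
  have hpG : (P G).toReal = ∫ ω, G.indicator 1 ω ∂P := by
    rw [integral_indicator_one hGm, Measure.real]
  have hpN : (P NN).toReal = ∫ ω, NN.indicator 1 ω ∂P := by
    rw [integral_indicator_one hNm, Measure.real]
  have e1 : dEM P Zi Zp (fun z z' ω => Y (Di z z' ω) (Dp z z' ω) ω *
      b2r (Di z z' ω)) true true true false =
      (∫ ω in T, Y true (Dp true true ω) ω ∂P) - ∫ ω in C, Y true (fun _ => false) ω ∂P := by
    refine (hΔ (fun d _ y => y * b2r d) (fun d dp => by fun_prop)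
      fun d dp => (hYint d dp).mul_const _).trans ?_
    rw [← integral_indicator hTm, ← integral_indicator hCm,
      ← integral_sub (hY1.indicator hTm) (hY0.indicator hCm)]
    refine integral_congr_ae ?_
    filter_upwards [hreg] with ω ⟨h0, h⟩
    rcases h with h | h | h | h | h <;> obtain ⟨ha, hb, hp, hωT, hωC, hωG, hωN⟩ := h <;>
      simp [h0, ha, hb, hp, hωT, hωC]
  have e2 : dEM P Zi Zp (fun z z' ω => b2r (Di z z' ω) *
      (1 - ∏ j, (1 - b2r (Dp z z' ω j)))) true true true false = (P T).toReal := by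
    refine (hΔ (fun d dp _ => b2r d * (1 - ∏ j, (1 - b2r (dp j)))) (fun d dp => by fun_prop)
      fun d dp => integrable_const _).trans ?_
    rw [hpT]
    refine integral_congr_ae ?_
    filter_upwards [hreg] with ω ⟨h0, h⟩
    rcases h with h | h | h | h | h <;> obtain ⟨ha, hb, hp, hωT, hωC, hωG, hωN⟩ := h <;>
      simp [h0, ha, hb, hp, hωT]
  have e3 : dEM P Zi Zp (fun z z' ω => Y (Di z z' ω) (Dp z z' ω) ω * (b2r (Di z z' ω) *
      ∏ j, (1 - b2r (Dp z z' ω j)))) true true true false =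
      -∫ ω in C, Y true (fun _ => false) ω ∂P := by
    refine (hΔ (fun d dp y => y * (b2r d * ∏ j, (1 - b2r (dp j)))) (fun d dp => by fun_prop)
      fun d dp => (hYint d dp).mul_const _).trans ?_
    rw [← integral_indicator hCm, ← integral_neg]
    refine integral_congr_ae ?_
    filter_upwards [hreg] with ω ⟨h0, h⟩
    rcases h with h | h | h | h | h <;> obtain ⟨ha, hb, hp, hωT, hωC, hωG, hωN⟩ := h <;>
      simp [h0, ha, hb, hp, hωC]
  have e4 : dEM P Zi Zp (fun z z' ω => b2r (Di z z' ω) *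
      ∏ j, (1 - b2r (Dp z z' ω j))) true true true false = -(P C).toReal := by
    refine (hΔ (fun d dp _ => b2r d * ∏ j, (1 - b2r (dp j))) (fun d dp => by fun_prop)
      fun d dp => integrable_const _).trans ?_
    rw [hpC, ← integral_neg]
    refine integral_congr_ae ?_
    filter_upwards [hreg] with ω ⟨h0, h⟩
    rcases h with h | h | h | h | h <;> obtain ⟨ha, hb, hp, hωT, hωC, hωG, hωN⟩ := h <;>
      simp [h0, ha, hb, hp, hωC]
  have e5 : dEM P Zi Zp (fun z z' ω => b2r (Di z z' ω)) true true true false =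
      (P G).toReal := by
    refine (hΔ (fun d _ _ => b2r d) (fun d dp => by fun_prop)
      fun d dp => integrable_const _).trans ?_
    rw [hpG]
    refine integral_congr_ae ?_
    filter_upwards [hreg] with ω ⟨h0, h⟩
    rcases h with h | h | h | h | h <;> obtain ⟨ha, hb, hp, hωT, hωC, hωG, hωN⟩ := h <;>
      simp [ha, hb, hωG]
  have e6 : cexp P (fun ω => Y (Di true true ω) (Dp true true ω) ω *
      ((1 - b2r (Di true true ω)) * ∏ j, (1 - b2r (Dp true true ω j))))
      (ZevM Zi Zp true true) = ∫ ω in NN, Y false (fun _ => false) ω ∂P := by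
    refine (hobs (fun d dp y => y * ((1 - b2r d) * ∏ j, (1 - b2r (dp j))))
      (fun d dp => by fun_prop) true true).trans ?_
    rw [← integral_indicator hNm]
    refine integral_congr_ae ?_
    filter_upwards [hreg] with ω ⟨h0, h⟩
    rcases h with h | h | h | h | h <;> obtain ⟨ha, hb, hp, hωT, hωC, hωG, hωN⟩ := h <;>
      simp [ha, hp, hωN]
  have e7 : cexp P (fun ω => (1 - b2r (Di true true ω)) *
      ∏ j, (1 - b2r (Dp true true ω j))) (ZevM Zi Zp true true) = (P NN).toReal := by
    refine (hobs (fun d dp _ => (1 - b2r d) * ∏ j, (1 - b2r (dp j)))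
      (fun d dp => by fun_prop) true true).trans ?_
    rw [hpN]
    refine integral_congr_ae ?_
    filter_upwards [hreg] with ω ⟨h0, h⟩
    rcases h with h | h | h | h | h <;> obtain ⟨ha, hb, hp, hωT, hωC, hωG, hωN⟩ := h <;>
      simp [ha, hp, hωN]
  have hCG : ∫ ω in T, Y true (fun _ => false) ω ∂P =
      (∫ ω in C, Y true (fun _ => false) ω ∂P) + ∫ ω in G, Y true (fun _ => false) ω ∂P := by
    rw [hCe, hGe, integral_inter_add_sdiff hdb hY0.integrableOn]
  have hτe : τ = ((∫ ω in T, Y true (Dp true true ω) ω ∂P) -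
      ((∫ ω in C, Y true (fun _ => false) ω ∂P) +
        ∫ ω in G, Y true (fun _ => false) ω ∂P)) / (P T).toReal := by
    rw [hτ, cexp, integral_sub hY1.integrableOn hY0.integrableOn, hCG]
  have hT0 : 0 < (P T).toReal := ENNReal.toReal_pos hTpos.ne' (measure_ne_top _ _)
  have hG0 : 0 < (P G).toReal := ENNReal.toReal_pos hGpos.ne' (measure_ne_top _ _)
  rw [e1, e2, e3, e4, e5] at hL
  rw [e1, e2, e5, e6, e7] at hU
  rw [neg_div_neg_eq] at hL
  have hgG : cexp P (Y true fun _ => false) G * (P G).toReal =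
      ∫ ω in G, Y true (fun _ => false) ω ∂P := div_mul_cancel₀ _ hG0.ne'
  rw [hL, hU, hτe, mul_div_assoc', mul_div_assoc', ← sub_div, ← sub_div,
    div_le_div_iff_of_pos_right hT0, div_le_div_iff_of_pos_right hT0, ← hgG]
  refine ⟨fun ⟨_, h⟩ => ?_, fun ⟨_, h⟩ => ?_⟩
  · have := mul_le_mul_of_nonneg_right h hG0.le
    simp only [cexp] at this ⊢
    linarith
  · have := mul_le_mul_of_nonneg_right h hG0.le
    simp only [cexp] at this ⊢
    linarith

end
end
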